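/- arXiv:1305.2403 — 13 statements merged into one kernel-verified Lean document; each statement's English description precedes it below -/
import Mathlib

section
/- Let λ ∈ ℂ with λ ≠ 0. Polynomials a, b, c ∈ ℂ[x, t] satisfy the centrality system D_x a = 0, D_x b = b, D_x c = 2c, x·(E_λ a − a) = 2λ·b, x·(E_λ b − b) = λ·c, and E_λ c = c, if and only if there exist ν, μ, α₀ ∈ ℂ such that a = ν t² + (νλ − 2μ) t + α₀, b = x·(μ − ν t), and c = ν x². (This is the classification of central quantum-symmetric metrics on the 2D bicrossproduct model quantum spacetime: up to overall normalisation the nondegenerate solutions are a = t² + (2β+λ)t + α, b = −x(t+β), c = x², together with the degenerate families with ν = 0.) -/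
open MvPolynomial

/-- The time-translation `E_λ : ℂ[x,t] → ℂ[x,t]`, fixing `x = X 0` and sending
`t = X 1` to `t - λ`. -/
noncomputable def Eshift (lam : ℂ) : MvPolynomial (Fin 2) ℂ →ₐ[ℂ] MvPolynomial (Fin 2) ℂ :=
  MvPolynomial.aeval ![X 0, X 1 - C lam]

/-- The Euler operator `D_x = x ∂/∂x` on `ℂ[x,t]`. -/
noncomputable def Dx (f : MvPolynomial (Fin 2) ℂ) : MvPolynomial (Fin 2) ℂ :=
  X 0 * MvPolynomial.pderiv 0 f

theorem coeff_Dx (f : MvPolynomial (Fin 2) ℂ) (m : Fin 2 →₀ ℕ) :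
    coeff m (Dx f) = (m 0 : ℂ) * coeff m f := by
  induction f using MvPolynomial.induction_on' with
  | monomial u r =>
    have h : Dx (monomial u r) = monomial u ((u 0 : ℂ) * r) := by
      unfold Dx
      rw [pderiv_monomial, X, monomial_mul]
      by_cases h0 : u 0 = 0
      · simp [h0]
      · have hu : Finsupp.single 0 1 + (u - Finsupp.single 0 1) = u := by
          ext i
          fin_cases i
          · simp; omega
          · simp
        rw [hu, one_mul, mul_comm]
    rw [h, coeff_monomial, coeff_monomial]
    split_ifs with h1
    · rw [h1]
    · simp
  | add p q hp hq =>
    have h : Dx (p + q) = Dx p + Dx q := by simp [Dx, mul_add]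
    rw [h, coeff_add, coeff_add, hp, hq]; ring

theorem Dx_eigen (n : ℕ) (f : MvPolynomial (Fin 2) ℂ) (h : Dx f = C (n : ℂ) * f) :
    ∃ p : Polynomial ℂ, f = X 0 ^ n * Polynomial.aeval (X 1) p := by
  refine ⟨∑ m ∈ f.support, Polynomial.monomial (m 1) (coeff m f), ?_⟩
  conv_lhs => rw [f.as_sum]
  rw [map_sum, Finset.mul_sum]
  refine Finset.sum_congr rfl fun m hm => ?_
  have h1 := congrArg (coeff m) h
  rw [coeff_Dx, coeff_C_mul] at h1
  have h2 : m 0 = n := by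
    exact_mod_cast mul_right_cancel₀ (mem_support_iff.mp hm) h1
  rw [Polynomial.aeval_monomial, monomial_eq, Finsupp.prod_fintype _ _ (by simp),
    Fin.prod_univ_two, h2, algebraMap_eq]
  ring

theorem Eshift_aeval (lam : ℂ) (p : Polynomial ℂ) :
    Eshift lam (Polynomial.aeval (X 1) p) =
      Polynomial.aeval (X 1) (p.comp (Polynomial.X - Polynomial.C lam)) := by
  rw [← Polynomial.aeval_algHom_apply, Polynomial.aeval_comp]
  simp [Eshift, algebraMap_eq]

theorem Eshift_X0 (lam : ℂ) : Eshift lam (X 0) = X 0 := by simp [Eshift]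

theorem Eshift_X1 (lam : ℂ) : Eshift lam (X 1) = X 1 - C lam := by simp [Eshift]

theorem Eshift_C (lam r : ℂ) : Eshift lam (C r) = C r := by simp [Eshift]

theorem aeval_X1_inj {p q : Polynomial ℂ}
    (h : (Polynomial.aeval (X 1 : MvPolynomial (Fin 2) ℂ)) p = Polynomial.aeval (X 1) q) :
    p = q := by
  have h1 := congrArg (MvPolynomial.aeval ![(0 : Polynomial ℂ), Polynomial.X]) h
  rw [← Polynomial.aeval_algHom_apply, ← Polynomial.aeval_algHom_apply] at h1
  simpa using h1

theorem shift_const (lam : ℂ) (hlam : lam ≠ 0) (p : Polynomial ℂ)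
    (h : p.comp (Polynomial.X - Polynomial.C lam) = p) : ∃ r, p = Polynomial.C r := by
  refine ⟨p.eval 0, ?_⟩
  have h1 : ∀ n : ℕ, p.eval (-(n : ℂ) * lam) = p.eval 0 := by
    intro n
    induction n with
    | zero => simp
    | succ k ih =>
      rw [← ih]
      conv_rhs => rw [← h]
      rw [Polynomial.eval_comp]
      congr 1
      simp
      ring
  refine Polynomial.eq_of_infinite_eval_eq _ _ ?_
  refine Set.Infinite.mono (s := Set.range fun n : ℕ => -(n : ℂ) * lam) ?_ ?_
  · rintro _ ⟨n, rfl⟩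
    simpa using h1 n
  · refine Set.infinite_range_of_injective fun m n hmn => ?_
    simpa [hlam] using hmn

/-- Classification of central quantum-symmetric metrics on the 2D bicrossproduct
model quantum spacetime: the centrality system for the coefficients `(a,b,c)` holds
iff they take the stated form for some `ν, μ, α₀ ∈ ℂ`. -/
theorem stmt_2 (lam : ℂ) (hlam : lam ≠ 0) (a b c : MvPolynomial (Fin 2) ℂ) :
    (Dx a = 0 ∧ Dx b = b ∧ Dx c = 2 * c ∧
      X 0 * (Eshift lam a - a) = 2 * C lam * b ∧
      X 0 * (Eshift lam b - b) = C lam * c ∧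
      Eshift lam c = c)
    ↔ ∃ ν μ α₀ : ℂ,
        a = C ν * X 1 ^ 2 + C (ν * lam - 2 * μ) * X 1 + C α₀ ∧
        b = X 0 * (C μ - C ν * X 1) ∧
        c = C ν * X 0 ^ 2 := by
  constructor
  · rintro ⟨ha, hb, hc, h1, h2, h3⟩
    obtain ⟨p, rfl⟩ := Dx_eigen 0 a (by simpa using ha)
    obtain ⟨q, rfl⟩ := Dx_eigen 1 b (by simpa using hb)
    obtain ⟨r, rfl⟩ := Dx_eigen 2 c (by
      rw [hc]; congr 1)
    have hX : (X 0 : MvPolynomial (Fin 2) ℂ) ≠ 0 := X_ne_zero 0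
    simp only [map_mul, map_pow, Eshift_X0, Eshift_aeval, pow_zero, one_mul, pow_one] at h1 h2 h3
    have h3' := aeval_X1_inj (mul_left_cancel₀ (pow_ne_zero 2 hX) h3)
    obtain ⟨ν, rfl⟩ := shift_const lam hlam r h3'
    have h2' : q.comp (Polynomial.X - Polynomial.C lam) - q
        = Polynomial.C lam * Polynomial.C ν := by
      apply aeval_X1_inj
      apply mul_left_cancel₀ (pow_ne_zero 2 hX)
      simp only [map_sub, map_mul, Polynomial.aeval_C, algebraMap_eq] at h2 ⊢
      linear_combination h2
    obtain ⟨μ, hμ⟩ := shift_const lam hlam (q + Polynomial.C ν * Polynomial.X) (by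
      simp only [Polynomial.add_comp, Polynomial.mul_comp, Polynomial.C_comp, Polynomial.X_comp]
      linear_combination h2')
    obtain rfl : q = Polynomial.C μ - Polynomial.C ν * Polynomial.X := by
      linear_combination hμ
    have h1' : p.comp (Polynomial.X - Polynomial.C lam) - p
        = 2 * Polynomial.C lam * (Polynomial.C μ - Polynomial.C ν * Polynomial.X) := by
      apply aeval_X1_inj
      apply mul_left_cancel₀ hX
      simp only [map_sub, map_mul, Polynomial.aeval_C, algebraMap_eq, map_ofNat] at h1 ⊢
      linear_combination h1
    obtain ⟨α, hα⟩ := shift_const lam hlam (p - Polynomial.C ν * Polynomial.X ^ 2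
        - (Polynomial.C ν * Polynomial.C lam - 2 * Polynomial.C μ) * Polynomial.X) (by
      simp only [Polynomial.sub_comp, Polynomial.mul_comp, Polynomial.C_comp, Polynomial.X_comp,
        Polynomial.pow_comp, Polynomial.ofNat_comp]
      linear_combination h1')
    obtain rfl : p = Polynomial.C ν * Polynomial.X ^ 2
        + (Polynomial.C ν * Polynomial.C lam - 2 * Polynomial.C μ) * Polynomial.X
        + Polynomial.C α := by
      linear_combination hα
    refine ⟨ν, μ, α, ?_, ?_, ?_⟩
    · have h2C : (C 2 : MvPolynomial (Fin 2) ℂ) = 2 := map_ofNat C 2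
      simp only [map_add, map_sub, map_mul, map_pow, Polynomial.aeval_C, Polynomial.aeval_X,
        algebraMap_eq, map_ofNat, h2C]
      ring
    · simp [algebraMap_eq]
    · simp [algebraMap_eq, mul_comm]
  · rintro ⟨ν, μ, α, rfl, rfl, rfl⟩
    have h01 : pderiv (R := ℂ) (0 : Fin 2) (X 1) = 0 := pderiv_X_of_ne (by decide)
    have h2 : (C 2 : MvPolynomial (Fin 2) ℂ) = 2 := map_ofNat C 2
    refine ⟨?_, ?_, ?_, ?_, ?_, ?_⟩
    · simp [Dx, pderiv_mul, pderiv_pow, h01]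
    · simp [Dx, pderiv_mul, h01]
    · simp [Dx, pderiv_mul, pderiv_pow]; ring
    · simp only [map_add, map_sub, map_mul, map_pow, Eshift_X0, Eshift_X1, Eshift_C, h2, map_ofNat]
      ring
    · simp only [map_add, map_sub, map_mul, map_pow, Eshift_X0, Eshift_X1, Eshift_C]
      ring
    · simp only [map_mul, map_pow, Eshift_X0, Eshift_C]
end

section
/- Let λ ∈ ℂ with λ ≠ 0 and let m ≥ 2. Suppose polynomials a_{ij} (for i, j ∈ {1,…,m}, with a_{ij} = a_{ji}), b_i (for i ∈ {1,…,m}) and c in ℂ[x₁,…,x_m, t] satisfy: D a_{ij} = 0, D b_i = b_i, D c = 2c for all i, j; x_k·(E_λ a_{ij} − a_{ij}) = 0 whenever k ∉ {i, j}; x_k·(E_λ a_{ik} − a_{ik}) = λ·b_i for all i, k; x_k·(E_λ b_i − b_i) = 0 whenever k ≠ i; x_k·(E_λ b_k − b_k) = λ·c for all k; and x_k·(E_λ c − c) = 0 for all k. Then b_i = 0 for every i and c = 0. (Hence for n > 2 the bicrossproduct model quantum spacetime admits no central quantum-symmetric metric other than the degenerate ones with purely spatial coefficients.) -/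
open MvPolynomial

/-- The time-translation `E_λ` on `ℂ[x₁,…,x_m,t]`, fixing each `x_k = X (inl k)`
and sending `t = X (inr ())` to `t - λ`. -/
noncomputable def EshiftN (m : ℕ) (lam : ℂ) :
    MvPolynomial (Fin m ⊕ Unit) ℂ →ₐ[ℂ] MvPolynomial (Fin m ⊕ Unit) ℂ :=
  MvPolynomial.aeval (Sum.elim (fun k => X (Sum.inl k)) (fun _ => X (Sum.inr ()) - C lam))

/-- The Euler operator `D = Σ_k x_k ∂/∂x_k` on `ℂ[x₁,…,x_m,t]`. -/
noncomputable def EulerN (m : ℕ) (f : MvPolynomial (Fin m ⊕ Unit) ℂ) :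
    MvPolynomial (Fin m ⊕ Unit) ℂ :=
  ∑ k : Fin m, X (Sum.inl k) * MvPolynomial.pderiv (Sum.inl k) f

/-- For `n = m + 1 > 2` the bicrossproduct model quantum spacetime admits no central
quantum-symmetric metric other than the degenerate purely spatial ones: the
centrality system forces `b_i = 0` for all `i` and `c = 0`. -/
theorem stmt_3 (m : ℕ) (hm : 2 ≤ m) (lam : ℂ) (hlam : lam ≠ 0)
    (a : Fin m → Fin m → MvPolynomial (Fin m ⊕ Unit) ℂ)
    (b : Fin m → MvPolynomial (Fin m ⊕ Unit) ℂ)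
    (c : MvPolynomial (Fin m ⊕ Unit) ℂ)
    (hsym : ∀ i j, a i j = a j i)
    (hDa : ∀ i j, EulerN m (a i j) = 0)
    (hDb : ∀ i, EulerN m (b i) = b i)
    (hDc : EulerN m c = 2 * c)
    (hak : ∀ i j k, k ≠ i → k ≠ j → X (Sum.inl k) * (EshiftN m lam (a i j) - a i j) = 0)
    (hak2 : ∀ i k, X (Sum.inl k) * (EshiftN m lam (a i k) - a i k) = C lam * b i)
    (hbk : ∀ i k, k ≠ i → X (Sum.inl k) * (EshiftN m lam (b i) - b i) = 0)
    (hbk2 : ∀ k, X (Sum.inl k) * (EshiftN m lam (b k) - b k) = C lam * c)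
    (hck : ∀ k : Fin m, X (Sum.inl k) * (EshiftN m lam c - c) = 0) :
    (∀ i, b i = 0) ∧ c = 0 := by
  have hX : ∀ k : Fin m, (X (Sum.inl k) : MvPolynomial (Fin m ⊕ Unit) ℂ) ≠ 0 :=
    fun k => X_ne_zero _
  have hC : (C lam : MvPolynomial (Fin m ⊕ Unit) ℂ) ≠ 0 := by
    simpa using hlam
  have hne : ∀ i : Fin m, ∃ k, k ≠ i := by
    haveI : Nontrivial (Fin m) := Fin.nontrivial_iff_two_le.mpr hm
    exact fun i => exists_ne i
  refine ⟨fun i => ?_, ?_⟩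
  · obtain ⟨k, hk⟩ := hne i
    have h1 := (mul_eq_zero.mp (hak i i k hk hk)).resolve_left (hX k)
    have h2 := hak2 i i
    rw [h1, mul_zero] at h2
    exact (mul_eq_zero.mp h2.symm).resolve_left hC
  · obtain ⟨k, hk⟩ := hne ⟨0, by omega⟩
    have h1 := (mul_eq_zero.mp (hbk _ k hk)).resolve_left (hX k)
    have h2 := hbk2 ⟨0, by omega⟩
    rw [h1, mul_zero] at h2
    exact (mul_eq_zero.mp h2.symm).resolve_left hC
end

section
/- Let A be an associative unital ℂ-algebra, λ ∈ ℂ, and let t, r ∈ A with r invertible, together with a family of elements x_i ∈ A (i ranging over an index set), satisfying: x_i x_j = x_j x_i, x_i t − t x_i = λ x_i, r t − t r = λ r, and x_i r = r x_i for all i, j. Define x̂_i = r⁻² x_i, t̂ = (1/2)(r⁻¹ t + t r⁻¹), and r̂ = r⁻¹. Then the quadratic relations hold: x̂_i x̂_j = x̂_j x̂_i, x̂_i t̂ − t̂ x̂_i = −λ r̂ x̂_i, and r̂ t̂ − t̂ r̂ = −λ r̂². -/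
theorem hat_aux (A : Type*) [Ring A] [Algebra ℂ A] (lam : ℂ) (t s y : A)
    (hst : s * t = t * s - lam • s) (hy : y * t = t * y - lam • y) (hys : y * s = s * y) :
    y * ((2 : ℂ)⁻¹ • (s * t + t * s)) - ((2 : ℂ)⁻¹ • (s * t + t * s)) * y
      = -lam • (s * y) := by
  have hT : (2 : ℂ)⁻¹ • (s * t + t * s) = t * s - (2⁻¹ * lam) • s := by
    rw [hst]; module
  have h1 : y * (t * s) = t * (s * y) - lam • (s * y) := by
    rw [← mul_assoc, hy, sub_mul, smul_mul_assoc, mul_assoc, hys]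
  rw [hT, mul_sub, sub_mul, h1, mul_smul_comm, smul_mul_assoc, hys, mul_assoc]
  module

/-- The noncommutative inversion change of generators for the bicrossproduct model
quantum spacetime: if `x_i x_j = x_j x_i`, `[x_i, t] = λ x_i`, `[r, t] = λ r` and
`r` commutes with the `x_i` and is invertible with inverse `s`, then the hatted
generators `x̂_i = r⁻² x_i`, `t̂ = ½(r⁻¹ t + t r⁻¹)`, `r̂ = r⁻¹` satisfy quadratic
relations. -/
theorem stmt_4 (A : Type*) [Ring A] [Algebra ℂ A] (lam : ℂ) (ι : Type*)
    (x : ι → A) (t r s : A)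
    (hrs : r * s = 1) (hsr : s * r = 1)
    (hxx : ∀ i j, x i * x j = x j * x i)
    (hxt : ∀ i, x i * t - t * x i = lam • x i)
    (hrt : r * t - t * r = lam • r)
    (hxr : ∀ i, x i * r = r * x i) :
    (∀ i j, (s * s * x i) * (s * s * x j) = (s * s * x j) * (s * s * x i)) ∧
    (∀ i, (s * s * x i) * ((2 : ℂ)⁻¹ • (s * t + t * s))
        - ((2 : ℂ)⁻¹ • (s * t + t * s)) * (s * s * x i)
        = -lam • (s * (s * s * x i))) ∧
    (s * ((2 : ℂ)⁻¹ • (s * t + t * s)) - ((2 : ℂ)⁻¹ • (s * t + t * s)) * s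
        = -lam • (s * s)) := by
  have hst : s * t = t * s - lam • s := by
    have h : s * (r * t - t * r) * s = s * (lam • r) * s := by rw [hrt]
    have e1 : s * (r * t - t * r) * s = t * s - s * t := by
      have : s * (r * t - t * r) * s = (s * r) * t * s - s * t * (r * s) := by noncomm_ring
      rw [this, hrs, hsr, one_mul, mul_one]
    rw [e1, mul_smul_comm, hsr, smul_mul_assoc, one_mul] at h
    rw [← h]; abel
  have hxs : ∀ i, x i * s = s * x i := fun i => by
    calc x i * s = (s * r) * x i * s := by rw [hsr, one_mul]
      _ = s * (r * x i) * s := by noncomm_ring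
      _ = s * x i * (r * s) := by rw [← hxr]; noncomm_ring
      _ = s * x i := by rw [hrs, mul_one]
  have hc : ∀ i, Commute (x i) s := hxs
  refine ⟨fun i j => ?_, fun i => ?_, ?_⟩
  · have hss : Commute s s := Commute.refl s
    have hij : Commute (x i) (x j) := hxx i j
    have a : Commute (s * s * x i) s := (hss.mul_left hss).mul_left (hc i)
    have b : Commute (s * s * x i) (x j) :=
      (((hc j).symm).mul_left ((hc j).symm)).mul_left hij
    exact (a.mul_right a).mul_right b
  · apply hat_aux A lam t s _ hst
    · have hx : x i * t = t * x i + lam • x i := by rw [← hxt i]; abel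
      rw [mul_assoc (s * s), hx, mul_add, ← mul_assoc, mul_assoc s s t, hst, mul_sub,
        ← mul_assoc s t s, hst]
      simp only [sub_mul, mul_smul_comm, smul_mul_assoc, mul_assoc]
      module
    · rw [mul_assoc, hxs]; noncomm_ring
  · exact hat_aux A lam t s s hst hst rfl
end

section
/- For the metric g on U with parameters a ≠ 0, b ≠ 0, the Christoffel symbols Γ^l_{jk} = (1/2) Σ_m (g⁻¹)^{lm}(∂_j g_{mk} + ∂_k g_{jm} − ∂_m g_{jk}) are given at every point of U by: Γ^t_{tt} = −2bt/a, Γ^t_{tr} = Γ^t_{rt} = (a+2bt²)/(ar), Γ^t_{rr} = −2t(a+bt²)/(ar²), Γ^t_{θθ} = −t/a, Γ^t_{φφ} = −t sin²θ/a; Γ^r_{tt} = −2br/a, Γ^r_{tr} = Γ^r_{rt} = 2bt/a, Γ^r_{rr} = −2bt²/(ar), Γ^r_{θθ} = −r/a, Γ^r_{φφ} = −r sin²θ/a; Γ^θ_{rθ} = Γ^θ_{θr} = 1/r, Γ^θ_{φφ} = −sinθ·cosθ; Γ^φ_{rφ} = Γ^φ_{φr} = 1/r, Γ^φ_{θφ}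 = Γ^φ_{φθ} = cotθ; and all other Christoffel symbols vanish. -/
open Real

/-- The chart `U = {(t,r,θ,φ) : r > 0, 0 < θ < π}` (coordinates ordered `(t,r,θ,φ)`
as `p 0, p 1, p 2, p 3`). -/
def chartU : Set (Fin 4 → ℝ) := {p | 0 < p 1 ∧ 0 < p 2 ∧ p 2 < Real.pi}

/-- The metric matrix `g` with parameters `a, b`. -/
noncomputable def gmet (a b : ℝ) (p : Fin 4 → ℝ) : Matrix (Fin 4) (Fin 4) ℝ :=
  !![b * (p 1)^2, -(b * (p 1) * (p 0)), 0, 0;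
     -(b * (p 1) * (p 0)), a + b * (p 0)^2, 0, 0;
     0, 0, (p 1)^2, 0;
     0, 0, 0, (p 1)^2 * (Real.sin (p 2))^2]

/-- The inverse metric matrix `g⁻¹`. -/
noncomputable def ginv (a b : ℝ) (p : Fin 4 → ℝ) : Matrix (Fin 4) (Fin 4) ℝ :=
  !![(b * (p 0)^2 + a) / (a * b * (p 1)^2), (p 0) / (a * (p 1)), 0, 0;
     (p 0) / (a * (p 1)), 1 / a, 0, 0;
     0, 0, 1 / (p 1)^2, 0;
     0, 0, 0, 1 / ((p 1)^2 * (Real.sin (p 2))^2)]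

/-- Partial derivative `∂_j f` of a function of the coordinates. -/
noncomputable def pd (j : Fin 4) (f : (Fin 4 → ℝ) → ℝ) (p : Fin 4 → ℝ) : ℝ :=
  deriv (fun s => f (Function.update p j s)) (p j)

/-- Christoffel symbols `Γ^l_{jk} = ½ Σ_m (g⁻¹)^{lm}(∂_j g_{mk} + ∂_k g_{jm} − ∂_m g_{jk})`. -/
noncomputable def Gamma (a b : ℝ) (l j k : Fin 4) (p : Fin 4 → ℝ) : ℝ :=
  (1/2) * ∑ m, ginv a b p l m *
    (pd j (fun q => gmet a b q m k) p + pd k (fun q => gmet a b q j m) p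
      - pd m (fun q => gmet a b q j k) p)

/-- The claimed explicit values of the Christoffel symbols. -/
noncomputable def GammaVal (a b : ℝ) (l : Fin 4) (p : Fin 4 → ℝ) : Matrix (Fin 4) (Fin 4) ℝ :=
  ![!![-(2 * b * (p 0) / a), (a + 2 * b * (p 0)^2) / (a * (p 1)), 0, 0;
      (a + 2 * b * (p 0)^2) / (a * (p 1)), -(2 * (p 0) * (a + b * (p 0)^2) / (a * (p 1)^2)), 0, 0;
      0, 0, -(p 0 / a), 0;
      0, 0, 0, -(p 0 * (Real.sin (p 2))^2 / a)],
    !![-(2 * b * (p 1) / a), 2 * b * (p 0) / a, 0, 0;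
      2 * b * (p 0) / a, -(2 * b * (p 0)^2 / (a * (p 1))), 0, 0;
      0, 0, -(p 1 / a), 0;
      0, 0, 0, -(p 1 * (Real.sin (p 2))^2 / a)],
    !![0, 0, 0, 0;
      0, 0, 1 / (p 1), 0;
      0, 1 / (p 1), 0, 0;
      0, 0, 0, -(Real.sin (p 2) * Real.cos (p 2))],
    !![0, 0, 0, 0;
      0, 0, 0, 1 / (p 1);
      0, 0, 0, Real.cos (p 2) / Real.sin (p 2);
      0, 1 / (p 1), Real.cos (p 2) / Real.sin (p 2), 0]] l

/-- The coordinate derivatives of the metric. -/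
noncomputable def dgmet (a b : ℝ) (m : Fin 4) (p : Fin 4 → ℝ) : Matrix (Fin 4) (Fin 4) ℝ :=
  ![!![0, -(b * p 1), 0, 0; -(b * p 1), 2 * b * p 0, 0, 0; 0, 0, 0, 0; 0, 0, 0, 0],
    !![2 * b * p 1, -(b * p 0), 0, 0; -(b * p 0), 0, 0, 0; 0, 0, 2 * p 1, 0;
      0, 0, 0, 2 * p 1 * (Real.sin (p 2))^2],
    !![0, 0, 0, 0; 0, 0, 0, 0; 0, 0, 0, 0;
      0, 0, 0, 2 * (p 1)^2 * Real.sin (p 2) * Real.cos (p 2)],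
    !![0, 0, 0, 0; 0, 0, 0, 0; 0, 0, 0, 0; 0, 0, 0, 0]] m

lemma deriv_sin_sq (x : ℝ) : deriv (fun s => (Real.sin s)^2) x = 2 * Real.sin x * Real.cos x := by
  have h := (Real.hasDerivAt_sin x).pow 2
  simpa using h.deriv

lemma pd_gmet (a b : ℝ) (m j k : Fin 4) (p : Fin 4 → ℝ) :
    pd m (fun q => gmet a b q j k) p = dgmet a b m p j k := by
  unfold pd
  fin_cases m <;> fin_cases j <;> fin_cases k <;>
    simp [gmet, dgmet, Function.update_apply, deriv_sin_sq] <;> ring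

/-- The Christoffel symbols of the metric `g` on `U` are as stated. -/
theorem stmt_5 (a b : ℝ) (ha : a ≠ 0) (hb : b ≠ 0) (p : Fin 4 → ℝ) (hp : p ∈ chartU)
    (l j k : Fin 4) :
    Gamma a b l j k p = GammaVal a b l p j k := by
  obtain ⟨hr, h0, hpi⟩ := hp
  have hs : Real.sin (p 2) ≠ 0 := (Real.sin_pos_of_pos_of_lt_pi h0 hpi).ne'
  have hr' : p 1 ≠ 0 := hr.ne'
  simp only [_root_.Gamma, pd_gmet, Fin.sum_univ_four]
  fin_cases l <;> fin_cases j <;> fin_cases k <;>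
    simp [ginv, dgmet, GammaVal] <;> field_simp <;> ring
end

section
/- Take a = 1 and b = −β² with β ∈ ℝ, β ≠ 0, in the metric g on U, and let u = (u^t, u^r, u^θ, u^φ) = (1/(β r), 0, 0, 0). Then at every point of U: (i) Σ_{ij} g_{ij} u^i u^j = −1, and (ii) the raised-index Einstein tensor satisfies G^{ij} = (4/r²)·(g⁻¹)^{ij} + (4/r²)·u^i u^j. Thus the Einstein tensor is that of a perfect fluid with pressure p = 1/(2πG r²) and energy density ρ = 0 (in units with 8πG·T = G^{ij}). -/
open Real

/-- The Ricci tensor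
`R_{ij} = ∂_k Γ^k_{ij} − ∂_j Γ^k_{ik} + Γ^k_{kl} Γ^l_{ij} − Γ^k_{jl} Γ^l_{ik}`. -/
noncomputable def RicciT (a b : ℝ) (i j : Fin 4) (p : Fin 4 → ℝ) : ℝ :=
  (∑ k, pd k (fun q => Gamma a b k i j q) p)
    - (∑ k, pd j (fun q => Gamma a b k i k q) p)
    + (∑ k, ∑ l, Gamma a b k k l p * Gamma a b l i j p)
    - (∑ k, ∑ l, Gamma a b k j l p * Gamma a b l i k p)

/-- The scalar curvature `S = Σ_{ij} (g⁻¹)^{ij} R_{ij}`. -/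
noncomputable def ScalC (a b : ℝ) (p : Fin 4 → ℝ) : ℝ :=
  ∑ i, ∑ j, ginv a b p i j * RicciT a b i j p

/-- The Einstein tensor `G_{ij} = R_{ij} − ½ S g_{ij}`. -/
noncomputable def EinsteinT (a b : ℝ) (i j : Fin 4) (p : Fin 4 → ℝ) : ℝ :=
  RicciT a b i j p - (1/2) * ScalC a b p * gmet a b p i j

/-- The raised-index Einstein tensor `G^{ij} = Σ_{kl} (g⁻¹)^{ik}(g⁻¹)^{jl} G_{kl}`. -/
noncomputable def EinsteinUp (a b : ℝ) (i j : Fin 4) (p : Fin 4 → ℝ) : ℝ :=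
  ∑ k, ∑ l, ginv a b p i k * ginv a b p j l * EinsteinT a b k l p

/-- Closed form of the Christoffel symbols `Γ^t` (`a = 1`). -/
noncomputable def GamT (b : ℝ) (p : Fin 4 → ℝ) : Matrix (Fin 4) (Fin 4) ℝ :=
  !![-2 * b * p 0, (2 * b * (p 0)^2 + 1) / p 1, 0, 0;
     (2 * b * (p 0)^2 + 1) / p 1, -(2 * p 0 * (b * (p 0)^2 + 1)) / (p 1)^2, 0, 0;
     0, 0, -p 0, 0;
     0, 0, 0, -(p 0 * (Real.sin (p 2))^2)]

/-- Closed form of `Γ^r`. -/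
noncomputable def GamR (b : ℝ) (p : Fin 4 → ℝ) : Matrix (Fin 4) (Fin 4) ℝ :=
  !![-2 * b * p 1, 2 * b * p 0, 0, 0;
     2 * b * p 0, -(2 * b * (p 0)^2) / p 1, 0, 0;
     0, 0, -p 1, 0;
     0, 0, 0, -(p 1 * (Real.sin (p 2))^2)]

/-- Closed form of `Γ^θ`. -/
noncomputable def GamH (p : Fin 4 → ℝ) : Matrix (Fin 4) (Fin 4) ℝ :=
  !![0, 0, 0, 0;
     0, 0, 1 / p 1, 0;
     0, 1 / p 1, 0, 0;
     0, 0, 0, -(Real.sin (p 2) * Real.cos (p 2))]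

/-- Closed form of `Γ^φ`. -/
noncomputable def GamF (p : Fin 4 → ℝ) : Matrix (Fin 4) (Fin 4) ℝ :=
  !![0, 0, 0, 0;
     0, 0, 0, 1 / p 1;
     0, 0, 0, Real.cos (p 2) / Real.sin (p 2);
     0, 1 / p 1, Real.cos (p 2) / Real.sin (p 2), 0]

/-- Closed form of the partial derivatives of the metric. -/
noncomputable def dgT (b : ℝ) (p : Fin 4 → ℝ) : Matrix (Fin 4) (Fin 4) ℝ :=
  !![0, -(b * p 1), 0, 0; -(b * p 1), 2 * b * p 0, 0, 0; 0, 0, 0, 0; 0, 0, 0, 0]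

noncomputable def dgR (b : ℝ) (p : Fin 4 → ℝ) : Matrix (Fin 4) (Fin 4) ℝ :=
  !![2 * b * p 1, -(b * p 0), 0, 0; -(b * p 0), 0, 0, 0; 0, 0, 2 * p 1, 0;
     0, 0, 0, 2 * p 1 * (Real.sin (p 2))^2]

noncomputable def dgH (p : Fin 4 → ℝ) : Matrix (Fin 4) (Fin 4) ℝ :=
  !![0, 0, 0, 0; 0, 0, 0, 0; 0, 0, 0, 0;
     0, 0, 0, (p 1)^2 * (2 * Real.sin (p 2) * Real.cos (p 2))]

theorem pd0_gmet (b : ℝ) (j k : Fin 4) (p : Fin 4 → ℝ) :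
    pd 0 (fun q => gmet 1 b q j k) p = dgT b p j k := by
  fin_cases j <;> fin_cases k <;>
    simp [pd, gmet, dgT, Function.update] <;> ring

theorem pd1_gmet (b : ℝ) (j k : Fin 4) (p : Fin 4 → ℝ) :
    pd 1 (fun q => gmet 1 b q j k) p = dgR b p j k := by
  fin_cases j <;> fin_cases k <;>
    simp [pd, gmet, dgR, Function.update] <;> ring

theorem pd2_gmet (b : ℝ) (j k : Fin 4) (p : Fin 4 → ℝ) :
    pd 2 (fun q => gmet 1 b q j k) p = dgH p j k := by
  fin_cases j <;> fin_cases k <;>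
    simp [pd, gmet, dgH, Function.update]

theorem pd3_gmet (b : ℝ) (j k : Fin 4) (p : Fin 4 → ℝ) :
    pd 3 (fun q => gmet 1 b q j k) p = 0 := by
  fin_cases j <;> fin_cases k <;>
    simp [pd, gmet, Function.update]

theorem chart_ne {p : Fin 4 → ℝ} (hp : p ∈ chartU) : p 1 ≠ 0 ∧ Real.sin (p 2) ≠ 0 :=
  ⟨hp.1.ne', (Real.sin_pos_of_pos_of_lt_pi hp.2.1 hp.2.2).ne'⟩

theorem Gamma0 (b : ℝ) (hb : b ≠ 0) (j k : Fin 4) (p : Fin 4 → ℝ) (hp : p ∈ chartU) :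
    Gamma 1 b 0 j k p = GamT b p j k := by
  obtain ⟨hr', hs⟩ := chart_ne hp
  simp only [_root_.Gamma, Fin.sum_univ_four, pd0_gmet, pd1_gmet, pd2_gmet, pd3_gmet]
  fin_cases j <;> fin_cases k <;>
    simp [ginv, pd0_gmet, pd1_gmet, pd2_gmet, pd3_gmet, dgT, dgR, dgH, GamT] <;>
    field_simp <;> ring

theorem Gamma1 (b : ℝ) (hb : b ≠ 0) (j k : Fin 4) (p : Fin 4 → ℝ) (hp : p ∈ chartU) :
    Gamma 1 b 1 j k p = GamR b p j k := by
  obtain ⟨hr', hs⟩ := chart_ne hp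
  simp only [_root_.Gamma, Fin.sum_univ_four, pd0_gmet, pd1_gmet, pd2_gmet, pd3_gmet]
  fin_cases j <;> fin_cases k <;>
    simp [ginv, pd0_gmet, pd1_gmet, pd2_gmet, pd3_gmet, dgT, dgR, dgH, GamR] <;>
    field_simp <;> ring

theorem Gamma2 (b : ℝ) (hb : b ≠ 0) (j k : Fin 4) (p : Fin 4 → ℝ) (hp : p ∈ chartU) :
    Gamma 1 b 2 j k p = GamH p j k := by
  obtain ⟨hr', hs⟩ := chart_ne hp
  simp only [_root_.Gamma, Fin.sum_univ_four, pd0_gmet, pd1_gmet, pd2_gmet, pd3_gmet]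
  fin_cases j <;> fin_cases k <;>
    simp [ginv, pd0_gmet, pd1_gmet, pd2_gmet, pd3_gmet, dgT, dgR, dgH, GamH] <;>
    field_simp <;> ring

theorem Gamma3 (b : ℝ) (hb : b ≠ 0) (j k : Fin 4) (p : Fin 4 → ℝ) (hp : p ∈ chartU) :
    Gamma 1 b 3 j k p = GamF p j k := by
  obtain ⟨hr', hs⟩ := chart_ne hp
  simp only [_root_.Gamma, Fin.sum_univ_four, pd0_gmet, pd1_gmet, pd2_gmet, pd3_gmet]
  fin_cases j <;> fin_cases k <;>
    simp [ginv, pd0_gmet, pd1_gmet, pd2_gmet, pd3_gmet, dgT, dgR, dgH, GamF] <;>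
    field_simp <;> ring

theorem chartU_open : IsOpen chartU := by
  have e : chartU = {p | 0 < p 1} ∩ ({p | 0 < p 2} ∩ {p | p 2 < Real.pi}) := rfl
  rw [e]
  exact (isOpen_lt (by fun_prop) (by fun_prop)).inter
    ((isOpen_lt (by fun_prop) (by fun_prop)).inter (isOpen_lt (by fun_prop) (by fun_prop)))

theorem pd_congr (j : Fin 4) (f g : (Fin 4 → ℝ) → ℝ) (h : ∀ q ∈ chartU, f q = g q)
    (p : Fin 4 → ℝ) (hp : p ∈ chartU) : pd j f p = pd j g p := by
  unfold pd
  apply Filter.EventuallyEq.deriv_eq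
  have hc : Continuous (fun s : ℝ => Function.update p j s) := by fun_prop
  have := (chartU_open.preimage hc).mem_nhds (x := p j) (by simpa using hp)
  filter_upwards [this] with s hs
  exact h _ hs

theorem d_inv_sq (c x : ℝ) (hx : x ≠ 0) : deriv (fun s : ℝ => c / s ^ 2) x = -2 * c / x ^ 3 := by
  have := ((hasDerivAt_const x c).div ((hasDerivAt_id x).pow 2) (by simpa using hx)).deriv
  refine Eq.trans this ?_
  simp
  field_simp

theorem d_inv (c x : ℝ) (hx : x ≠ 0) : deriv (fun s : ℝ => c / s) x = -c / x ^ 2 := by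
  have := ((hasDerivAt_const x c).div (hasDerivAt_id x) (by simpa using hx)).deriv
  refine Eq.trans this ?_
  simp

theorem d_cot (x : ℝ) (hx : Real.sin x ≠ 0) :
    deriv (fun s : ℝ => Real.cos s / Real.sin s) x = -1 / Real.sin x ^ 2 := by
  have := ((Real.hasDerivAt_cos x).div (Real.hasDerivAt_sin x) hx).deriv
  refine Eq.trans this ?_
  rw [← Real.sin_sq_add_cos_sq x]
  ring

theorem d_sincos (x : ℝ) :
    deriv (fun s : ℝ => Real.sin s * Real.cos s) x = Real.cos x ^ 2 - Real.sin x ^ 2 := by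
  have := ((Real.hasDerivAt_sin x).mul (Real.hasDerivAt_cos x)).deriv
  refine Eq.trans this ?_
  ring

theorem d_cubic (b x : ℝ) :
    deriv (fun s : ℝ => 2 * s * (b * s ^ 2 + 1)) x = 2 * (3 * b * x ^ 2 + 1) := by
  have := (((hasDerivAt_id x).const_mul 2).mul
    ((((hasDerivAt_id x).pow 2).const_mul b).add_const 1)).deriv
  refine Eq.trans this ?_
  simp
  ring

theorem d_cubic_neg (b x : ℝ) :
    deriv (fun s : ℝ => -(2 * s * (b * s ^ 2 + 1))) x = -(2 * (3 * b * x ^ 2 + 1)) := by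
  rw [← d_cubic]
  exact deriv.fun_neg

/-- Closed form of the derivative of `GamT` in direction 0. -/
noncomputable def d0GamT (b : ℝ) (p : Fin 4 → ℝ) : Matrix (Fin 4) (Fin 4) ℝ :=
  !![-2 * b, 4 * b * p 0 / p 1, 0, 0;
     4 * b * p 0 / p 1, -(2 * (3 * b * (p 0)^2 + 1)) / (p 1)^2, 0, 0;
     0, 0, -1, 0;
     0, 0, 0, -(Real.sin (p 2))^2]

theorem pd0_Gamma0 (b : ℝ) (hb : b ≠ 0) (j k : Fin 4) (p : Fin 4 → ℝ) (hp : p ∈ chartU) :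
    pd 0 (fun q => Gamma 1 b 0 j k q) p = d0GamT b p j k := by
  rw [pd_congr 0 _ _ (fun q hq => Gamma0 b hb j k q hq) p hp]
  obtain ⟨hr', hs⟩ := chart_ne hp
  fin_cases j <;> fin_cases k <;>
    simp [pd, GamT, d0GamT, Function.update, d_inv_sq, d_inv, d_cot,
      d_sincos, d_cubic, d_cubic_neg, hr', hs] <;> (try field_simp) <;> (try ring)

/-- Closed form of the derivative of `GamR` in direction 0. -/
noncomputable def d0GamR (b : ℝ) (p : Fin 4 → ℝ) : Matrix (Fin 4) (Fin 4) ℝ :=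
  !![0, 2 * b, 0, 0; 2 * b, -(4 * b * p 0) / p 1, 0, 0; 0, 0, 0, 0; 0, 0, 0, 0]

theorem pd0_Gamma1 (b : ℝ) (hb : b ≠ 0) (j k : Fin 4) (p : Fin 4 → ℝ) (hp : p ∈ chartU) :
    pd 0 (fun q => Gamma 1 b 1 j k q) p = d0GamR b p j k := by
  rw [pd_congr 0 _ _ (fun q hq => Gamma1 b hb j k q hq) p hp]
  obtain ⟨hr', hs⟩ := chart_ne hp
  fin_cases j <;> fin_cases k <;>
    simp [pd, GamR, d0GamR, Function.update, d_inv_sq, d_inv, d_cot,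
      d_sincos, d_cubic, d_cubic_neg, hr', hs] <;> (try field_simp) <;> (try ring)

theorem pd0_Gamma2 (b : ℝ) (hb : b ≠ 0) (j k : Fin 4) (p : Fin 4 → ℝ) (hp : p ∈ chartU) :
    pd 0 (fun q => Gamma 1 b 2 j k q) p = 0 := by
  rw [pd_congr 0 _ _ (fun q hq => Gamma2 b hb j k q hq) p hp]
  fin_cases j <;> fin_cases k <;>
    simp [pd, GamH, Function.update]

theorem pd0_Gamma3 (b : ℝ) (hb : b ≠ 0) (j k : Fin 4) (p : Fin 4 → ℝ) (hp : p ∈ chartU) :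
    pd 0 (fun q => Gamma 1 b 3 j k q) p = 0 := by
  rw [pd_congr 0 _ _ (fun q hq => Gamma3 b hb j k q hq) p hp]
  fin_cases j <;> fin_cases k <;>
    simp [pd, GamF, Function.update]

/-- Closed form of the derivative of `GamT` in direction 1. -/
noncomputable def d1GamT (b : ℝ) (p : Fin 4 → ℝ) : Matrix (Fin 4) (Fin 4) ℝ :=
  !![0, -(2 * b * (p 0)^2 + 1) / (p 1)^2, 0, 0;
     -(2 * b * (p 0)^2 + 1) / (p 1)^2, 4 * p 0 * (b * (p 0)^2 + 1) / (p 1)^3, 0, 0;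
     0, 0, 0, 0; 0, 0, 0, 0]

theorem pd1_Gamma0 (b : ℝ) (hb : b ≠ 0) (j k : Fin 4) (p : Fin 4 → ℝ) (hp : p ∈ chartU) :
    pd 1 (fun q => Gamma 1 b 0 j k q) p = d1GamT b p j k := by
  rw [pd_congr 1 _ _ (fun q hq => Gamma0 b hb j k q hq) p hp]
  obtain ⟨hr', hs⟩ := chart_ne hp
  fin_cases j <;> fin_cases k <;>
    simp [pd, GamT, d1GamT, Function.update, d_inv_sq, d_inv, d_cot,
      d_sincos, d_cubic, d_cubic_neg, hr', hs] <;> (try field_simp) <;> (try ring)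

/-- Closed form of the derivative of `GamR` in direction 1. -/
noncomputable def d1GamR (b : ℝ) (p : Fin 4 → ℝ) : Matrix (Fin 4) (Fin 4) ℝ :=
  !![-2 * b, 0, 0, 0; 0, 2 * b * (p 0)^2 / (p 1)^2, 0, 0; 0, 0, -1, 0;
     0, 0, 0, -(Real.sin (p 2))^2]

theorem pd1_Gamma1 (b : ℝ) (hb : b ≠ 0) (j k : Fin 4) (p : Fin 4 → ℝ) (hp : p ∈ chartU) :
    pd 1 (fun q => Gamma 1 b 1 j k q) p = d1GamR b p j k := by
  rw [pd_congr 1 _ _ (fun q hq => Gamma1 b hb j k q hq) p hp]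
  obtain ⟨hr', hs⟩ := chart_ne hp
  fin_cases j <;> fin_cases k <;>
    simp [pd, GamR, d1GamR, Function.update, d_inv_sq, d_inv, d_cot,
      d_sincos, d_cubic, d_cubic_neg, hr', hs] <;> (try field_simp) <;> (try ring)

/-- Closed form of the derivative of `GamH` in direction 1. -/
noncomputable def d1GamH (p : Fin 4 → ℝ) : Matrix (Fin 4) (Fin 4) ℝ :=
  !![0, 0, 0, 0; 0, 0, -1 / (p 1)^2, 0; 0, -1 / (p 1)^2, 0, 0; 0, 0, 0, 0]

theorem pd1_Gamma2 (b : ℝ) (hb : b ≠ 0) (j k : Fin 4) (p : Fin 4 → ℝ) (hp : p ∈ chartU) :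
    pd 1 (fun q => Gamma 1 b 2 j k q) p = d1GamH p j k := by
  rw [pd_congr 1 _ _ (fun q hq => Gamma2 b hb j k q hq) p hp]
  obtain ⟨hr', hs⟩ := chart_ne hp
  fin_cases j <;> fin_cases k <;>
    simp [pd, GamH, d1GamH, Function.update, d_inv_sq, d_inv, d_cot,
      d_sincos, d_cubic, d_cubic_neg, hr', hs] <;> (try field_simp) <;> (try ring)

/-- Closed form of the derivative of `GamF` in direction 1. -/
noncomputable def d1GamF (p : Fin 4 → ℝ) : Matrix (Fin 4) (Fin 4) ℝ :=
  !![0, 0, 0, 0; 0, 0, 0, -1 / (p 1)^2; 0, 0, 0, 0; 0, -1 / (p 1)^2, 0, 0]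

theorem pd1_Gamma3 (b : ℝ) (hb : b ≠ 0) (j k : Fin 4) (p : Fin 4 → ℝ) (hp : p ∈ chartU) :
    pd 1 (fun q => Gamma 1 b 3 j k q) p = d1GamF p j k := by
  rw [pd_congr 1 _ _ (fun q hq => Gamma3 b hb j k q hq) p hp]
  obtain ⟨hr', hs⟩ := chart_ne hp
  fin_cases j <;> fin_cases k <;>
    simp [pd, GamF, d1GamF, Function.update, d_inv_sq, d_inv, d_cot,
      d_sincos, d_cubic, d_cubic_neg, hr', hs] <;> (try field_simp) <;> (try ring)

/-- Closed form of the derivative of `GamT` in direction 2. -/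
noncomputable def d2GamT (p : Fin 4 → ℝ) : Matrix (Fin 4) (Fin 4) ℝ :=
  !![0, 0, 0, 0; 0, 0, 0, 0; 0, 0, 0, 0;
     0, 0, 0, -(p 0 * (2 * Real.sin (p 2) * Real.cos (p 2)))]

theorem pd2_Gamma0 (b : ℝ) (hb : b ≠ 0) (j k : Fin 4) (p : Fin 4 → ℝ) (hp : p ∈ chartU) :
    pd 2 (fun q => Gamma 1 b 0 j k q) p = d2GamT p j k := by
  rw [pd_congr 2 _ _ (fun q hq => Gamma0 b hb j k q hq) p hp]
  obtain ⟨hr', hs⟩ := chart_ne hp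
  fin_cases j <;> fin_cases k <;>
    simp [pd, GamT, d2GamT, Function.update, d_inv_sq, d_inv, d_cot,
      d_sincos, d_cubic, d_cubic_neg, hr', hs] <;> (try field_simp) <;> (try ring)

/-- Closed form of the derivative of `GamR` in direction 2. -/
noncomputable def d2GamR (p : Fin 4 → ℝ) : Matrix (Fin 4) (Fin 4) ℝ :=
  !![0, 0, 0, 0; 0, 0, 0, 0; 0, 0, 0, 0;
     0, 0, 0, -(p 1 * (2 * Real.sin (p 2) * Real.cos (p 2)))]

theorem pd2_Gamma1 (b : ℝ) (hb : b ≠ 0) (j k : Fin 4) (p : Fin 4 → ℝ) (hp : p ∈ chartU) :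
    pd 2 (fun q => Gamma 1 b 1 j k q) p = d2GamR p j k := by
  rw [pd_congr 2 _ _ (fun q hq => Gamma1 b hb j k q hq) p hp]
  obtain ⟨hr', hs⟩ := chart_ne hp
  fin_cases j <;> fin_cases k <;>
    simp [pd, GamR, d2GamR, Function.update, d_inv_sq, d_inv, d_cot,
      d_sincos, d_cubic, d_cubic_neg, hr', hs] <;> (try field_simp) <;> (try ring)

/-- Closed form of the derivative of `GamH` in direction 2. -/
noncomputable def d2GamH (p : Fin 4 → ℝ) : Matrix (Fin 4) (Fin 4) ℝ :=
  !![0, 0, 0, 0; 0, 0, 0, 0; 0, 0, 0, 0;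
     0, 0, 0, (Real.sin (p 2))^2 - (Real.cos (p 2))^2]

theorem pd2_Gamma2 (b : ℝ) (hb : b ≠ 0) (j k : Fin 4) (p : Fin 4 → ℝ) (hp : p ∈ chartU) :
    pd 2 (fun q => Gamma 1 b 2 j k q) p = d2GamH p j k := by
  rw [pd_congr 2 _ _ (fun q hq => Gamma2 b hb j k q hq) p hp]
  obtain ⟨hr', hs⟩ := chart_ne hp
  fin_cases j <;> fin_cases k <;>
    simp [pd, GamH, d2GamH, Function.update, d_inv_sq, d_inv, d_cot,
      d_sincos, d_cubic, d_cubic_neg, hr', hs] <;> (try field_simp) <;> (try ring)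

/-- Closed form of the derivative of `GamF` in direction 2. -/
noncomputable def d2GamF (p : Fin 4 → ℝ) : Matrix (Fin 4) (Fin 4) ℝ :=
  !![0, 0, 0, 0; 0, 0, 0, 0; 0, 0, 0, -1 / (Real.sin (p 2))^2;
     0, 0, -1 / (Real.sin (p 2))^2, 0]

theorem pd2_Gamma3 (b : ℝ) (hb : b ≠ 0) (j k : Fin 4) (p : Fin 4 → ℝ) (hp : p ∈ chartU) :
    pd 2 (fun q => Gamma 1 b 3 j k q) p = d2GamF p j k := by
  rw [pd_congr 2 _ _ (fun q hq => Gamma3 b hb j k q hq) p hp]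
  obtain ⟨hr', hs⟩ := chart_ne hp
  fin_cases j <;> fin_cases k <;>
    simp [pd, GamF, d2GamF, Function.update, d_inv_sq, d_inv, d_cot,
      d_sincos, d_cubic, d_cubic_neg, hr', hs] <;> (try field_simp) <;> (try simp only [Real.cos_sq' (p 2)]) <;> (try ring)

theorem pd3_Gamma (b : ℝ) (hb : b ≠ 0) (l j k : Fin 4) (p : Fin 4 → ℝ) (hp : p ∈ chartU) :
    pd 3 (fun q => Gamma 1 b l j k q) p = 0 := by
  fin_cases l
  · refine (pd_congr 3 _ _ (fun q hq => Gamma0 b hb j k q hq) p hp).trans ?_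
    fin_cases j <;> fin_cases k <;> simp [pd, GamT, Function.update]
  · refine (pd_congr 3 _ _ (fun q hq => Gamma1 b hb j k q hq) p hp).trans ?_
    fin_cases j <;> fin_cases k <;> simp [pd, GamR, Function.update]
  · refine (pd_congr 3 _ _ (fun q hq => Gamma2 b hb j k q hq) p hp).trans ?_
    fin_cases j <;> fin_cases k <;> simp [pd, GamH, Function.update]
  · refine (pd_congr 3 _ _ (fun q hq => Gamma3 b hb j k q hq) p hp).trans ?_
    fin_cases j <;> fin_cases k <;> simp [pd, GamF, Function.update]

/-- Closed form of the Ricci tensor. -/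
noncomputable def RicC (b : ℝ) (p : Fin 4 → ℝ) : Matrix (Fin 4) (Fin 4) ℝ :=
  !![-6 * b, 6 * b * p 0 / p 1, 0, 0;
     6 * b * p 0 / p 1, -(2 + 6 * b * (p 0)^2) / (p 1)^2, 0, 0;
     0, 0, -2, 0;
     0, 0, 0, -2 * (Real.sin (p 2))^2]

theorem Ricci_eq (b : ℝ) (hb : b ≠ 0) (i j : Fin 4) (p : Fin 4 → ℝ) (hp : p ∈ chartU) :
    RicciT 1 b i j p = RicC b p i j := by
  obtain ⟨hr', hs⟩ := chart_ne hp
  have hc : Real.cos (p 2) ^ 2 = 1 - Real.sin (p 2) ^ 2 := Real.cos_sq' _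
  simp only [RicciT, Fin.sum_univ_four, Gamma0 b hb _ _ p hp, Gamma1 b hb _ _ p hp,
    Gamma2 b hb _ _ p hp, Gamma3 b hb _ _ p hp]
  fin_cases i <;> fin_cases j <;>
  simp only [Fin.zero_eta, Fin.mk_one, Fin.reduceFinMk, pd0_Gamma0 b hb _ _ p hp, pd0_Gamma1 b hb _ _ p hp, pd0_Gamma2 b hb _ _ p hp,
    pd0_Gamma3 b hb _ _ p hp, pd1_Gamma0 b hb _ _ p hp, pd1_Gamma1 b hb _ _ p hp,
    pd1_Gamma2 b hb _ _ p hp, pd1_Gamma3 b hb _ _ p hp, pd2_Gamma0 b hb _ _ p hp,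
    pd2_Gamma1 b hb _ _ p hp, pd2_Gamma2 b hb _ _ p hp, pd2_Gamma3 b hb _ _ p hp,
    pd3_Gamma b hb _ _ _ p hp] <;>
  simp [RicC, GamT, GamR, GamH, GamF, d0GamT, d0GamR, d1GamT, d1GamR, d1GamH,
    d1GamF, d2GamT, d2GamR, d2GamH, d2GamF] <;>
  (try field_simp) <;> (try simp only [hc]) <;> (try ring)

theorem Scal_eq (b : ℝ) (hb : b ≠ 0) (p : Fin 4 → ℝ) (hp : p ∈ chartU) :
    ScalC 1 b p = -12 / (p 1)^2 := by
  obtain ⟨hr', hs⟩ := chart_ne hp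
  simp only [ScalC, Ricci_eq b hb _ _ p hp]
  simp [Fin.sum_univ_four, ginv, RicC]
  field_simp
  ring

/-- Case `a = 1`, `b = −β²`: with `u = (1/(βr), 0, 0, 0)` we have `g(u,u) = −1` and
`G^{ij} = (4/r²)(g⁻¹)^{ij} + (4/r²) u^i u^j`, the Einstein tensor of a perfect fluid
with pressure `p = 1/(2πG r²)` and energy density `ρ = 0`. -/
theorem stmt_7 (β : ℝ) (hβ : β ≠ 0) (p : Fin 4 → ℝ) (hp : p ∈ chartU) :
    (∑ i, ∑ j, gmet 1 (-β^2) p i j * (![1/(β * p 1), 0, 0, 0] : Fin 4 → ℝ) i *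
        (![1/(β * p 1), 0, 0, 0] : Fin 4 → ℝ) j) = -1 ∧
    (∀ i j, EinsteinUp 1 (-β^2) i j p
      = (4/(p 1)^2) * ginv 1 (-β^2) p i j
        + (4/(p 1)^2) * (![1/(β * p 1), 0, 0, 0] : Fin 4 → ℝ) i *
          (![1/(β * p 1), 0, 0, 0] : Fin 4 → ℝ) j) := by
  obtain ⟨hr', hs⟩ := chart_ne hp
  have hb : -β ^ 2 ≠ 0 := by simpa using hβ
  constructor
  · simp [Fin.sum_univ_four, gmet]
    field_simp
  · intro i j
    simp only [EinsteinUp, EinsteinT, Ricci_eq _ hb _ _ p hp, Scal_eq _ hb p hp]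
    fin_cases i <;> fin_cases j <;>
      simp [Fin.sum_univ_four, ginv, gmet, RicC] <;> field_simp <;> ring
end

section
/- Let a, b ∈ ℝ with a ≠ 0, let I ⊆ ℝ be an open interval, and let r, t : I → ℝ be twice differentiable with r(τ) > 0 for all τ ∈ I, and let φ : I → ℝ be differentiable. Suppose the geodesic equations a·r″ = r·(φ′)² + (2b/r)·(r t′ − t r′)² and a·t″ = t·(φ′)² − (2a r′/r²)·(r t′ − t r′) + (2bt/r²)·(r t′ − t r′)² hold on I. Then the function τ ↦ r(τ)²·(r(τ)·t′(τ) − t(τ)·r′(τ)) is constant on I. -/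
/-- For the radial–time sector of the geodesic flow of the metric
`g = b r² dt² + (a + b t²) dr² − 2 b r t dr dt + r²(dθ² + sin²θ dφ²)` in the
equatorial plane, the quantity `M = r²(r t′ − t r′)` is a constant of motion. -/
theorem stmt_9 (a b : ℝ) (ha : a ≠ 0) (I : Set ℝ) (hIopen : IsOpen I)
    (hIconn : IsPreconnected I)
    (r t φ r' t' φ' r'' t'' : ℝ → ℝ)
    (hrpos : ∀ τ ∈ I, 0 < r τ)
    (hr' : ∀ τ ∈ I, HasDerivAt r (r' τ) τ)
    (hr'' : ∀ τ ∈ I, HasDerivAt r' (r'' τ) τ)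
    (ht' : ∀ τ ∈ I, HasDerivAt t (t' τ) τ)
    (ht'' : ∀ τ ∈ I, HasDerivAt t' (t'' τ) τ)
    (hφ' : ∀ τ ∈ I, HasDerivAt φ (φ' τ) τ)
    (hgeor : ∀ τ ∈ I, a * r'' τ
      = r τ * (φ' τ)^2 + (2 * b / r τ) * (r τ * t' τ - t τ * r' τ)^2)
    (hgeot : ∀ τ ∈ I, a * t'' τ
      = t τ * (φ' τ)^2 - (2 * a * r' τ / (r τ)^2) * (r τ * t' τ - t τ * r' τ)
        + (2 * b * t τ / (r τ)^2) * (r τ * t' τ - t τ * r' τ)^2) :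
    ∀ τ₁ ∈ I, ∀ τ₂ ∈ I,
      (r τ₁)^2 * (r τ₁ * t' τ₁ - t τ₁ * r' τ₁)
        = (r τ₂)^2 * (r τ₂ * t' τ₂ - t τ₂ * r' τ₂) := by
  have hD : ∀ τ ∈ I, HasDerivAt (fun τ => (r τ)^2 * (r τ * t' τ - t τ * r' τ)) 0 τ := by
    intro τ hτ
    have hr0 : r τ ≠ 0 := (hrpos τ hτ).ne'
    have h := ((hr' τ hτ).fun_pow 2).fun_mul
      (((hr' τ hτ).fun_mul (ht'' τ hτ)).fun_sub ((ht' τ hτ).fun_mul (hr'' τ hτ)))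
    refine h.congr_deriv ?_
    have h1 := hgeor τ hτ
    have h2 := hgeot τ hτ
    have key : a * (r τ * t'' τ - t τ * r'' τ)
        = -(2 * a * r' τ / r τ) * (r τ * t' τ - t τ * r' τ) := by
      have e : a * (r τ * t'' τ - t τ * r'' τ) = r τ * (a * t'' τ) - t τ * (a * r'' τ) := by
        ring
      rw [e, h1, h2]
      field_simp
      ring
    have key2 : r τ * (r τ * t'' τ - t τ * r'' τ)
        = -(2 * r' τ) * (r τ * t' τ - t τ * r' τ) := by
      apply mul_left_cancel₀ ha
      calc a * (r τ * (r τ * t'' τ - t τ * r'' τ))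
          = r τ * (a * (r τ * t'' τ - t τ * r'' τ)) := by ring
        _ = _ := by rw [key]; field_simp
    push_cast
    linear_combination r τ * key2
  intro τ₁ h₁ τ₂ h₂
  exact hIopen.is_const_of_deriv_eq_zero hIconn
    (fun τ hτ => (hD τ hτ).differentiableAt.differentiableWithinAt)
    (fun τ hτ => (hD τ hτ).deriv) h₁ h₂
end

section
/- Let b ∈ ℝ with b < 0, let ε ∈ {1, −1}, and set k = 1/√(−b). Let I ⊆ ℝ be an open interval and r, t : I → ℝ differentiable with r(τ) > 0 for all τ ∈ I, satisfying the null condition r′ = ε·√(−b)·(r t′ − t r′) on I. Then the function τ ↦ (t(τ) + ε·k)/r(τ) is constant on I; i.e., there exists c ∈ ℝ with t(τ) = c·r(τ) − ε·k for all τ ∈ I, so the curve (r, t) lies on a straight line through the point P = (0, −ε/√(−b)). -/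
/-- Null curves of the 2D metric `g = dr⊗dr + b v⊗v`, `v = r dt − t dr`, `b < 0`:
on the branch `r′ = ε √(−b) (r t′ − t r′)` the quantity `(t + εk)/r` with
`k = 1/√(−b)` is constant, so the curve lies on a straight line through
`P = (0, −ε/√(−b))`. -/
theorem stmt_10 (b : ℝ) (hb : b < 0) (ε : ℝ) (hε : ε = 1 ∨ ε = -1)
    (I : Set ℝ) (hIopen : IsOpen I) (hIconn : IsPreconnected I)
    (r t r' t' : ℝ → ℝ)
    (hrpos : ∀ τ ∈ I, 0 < r τ)
    (hr' : ∀ τ ∈ I, HasDerivAt r (r' τ) τ)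
    (ht' : ∀ τ ∈ I, HasDerivAt t (t' τ) τ)
    (hnull : ∀ τ ∈ I, r' τ = ε * Real.sqrt (-b) * (r τ * t' τ - t τ * r' τ)) :
    ∃ c : ℝ, ∀ τ ∈ I, t τ = c * r τ - ε * (1 / Real.sqrt (-b)) := by
  have hs : 0 < Real.sqrt (-b) := Real.sqrt_pos.mpr (by linarith)
  have hε2 : ε * ε = 1 := by rcases hε with h | h <;> simp [h]
  set s := Real.sqrt (-b) with hsdef
  have hd : ∀ τ ∈ I, HasDerivAt (fun x => (t x + ε * (1 / s)) / r x) 0 τ := by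
    intro τ hτ
    have h := ((ht' τ hτ).add_const (ε * (1 / s))).div (hr' τ hτ) (hrpos τ hτ).ne'
    have h0 : t' τ * r τ - (t τ + ε * (1 / s)) * r' τ = 0 := by
      have h1 : ε * (1 / s) * r' τ = r τ * t' τ - t τ * r' τ := by
        calc ε * (1 / s) * r' τ
            = ε * (1 / s) * (ε * s * (r τ * t' τ - t τ * r' τ)) := by rw [← hnull τ hτ]
          _ = (ε * ε) * (1 / s * s) * (r τ * t' τ - t τ * r' τ) := by ring
          _ = _ := by rw [hε2, one_div_mul_cancel hs.ne']; ring
      linarith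
    rw [h0, zero_div] at h
    exact h
  obtain ⟨c, hc⟩ := hIopen.exists_is_const_of_deriv_eq_zero hIconn
    (fun τ hτ => (hd τ hτ).differentiableAt.differentiableWithinAt)
    (fun τ hτ => (hd τ hτ).deriv)
  refine ⟨c, fun τ hτ => ?_⟩
  have h := hc τ hτ
  rw [div_eq_iff (hrpos τ hτ).ne'] at h
  linarith
end

section
/- Let λ ∈ ℂ be purely imaginary with λ ≠ 0, and let (α, β, γ, δ, α′, β′, γ′, δ′) ∈ ℂ⁸ with α ≠ 0. Then the *-preservation equations (E1)–(E8) all hold if and only if the primed coefficients are given by the formulas (F1)–(F4). In particular, for each choice of (α, β, γ, δ) with α ≠ 0 there is exactly one *-preserving extension (α′, β′, γ′, δ′). -/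
/-- The *-preservation equations (E1)–(E8). -/
def StarEqs (lam α β γ δ α' β' γ' δ' : ℂ) : Prop :=
  (α - star α = lam * (star α * α' + α * star β) - lam^2 * (α * star α)) ∧
  (β - star β = lam * (β * star β + star α * (β' - 1)) - lam^2 * (star α * β)) ∧
  (γ - star γ = lam * (star β * γ + star α * (γ' - 1)) - lam^2 * (star α * γ)) ∧
  (δ - star δ = lam * (star α * δ' + star β * (δ - 1) - star γ) - lam^2 * (star α * (δ - 1))) ∧
  (α' - star α' = lam * (α * (star β' + 1) + α' * star α') - lam^2 * (star α' * α)) ∧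
  (β' - star β' = lam * (β * (star β' + 1) + star α' * (β' - 1)) - lam^2 * (star α' * β)) ∧
  (γ' - star γ' = lam * (γ * (star β' + 1) + star α' * (γ' - 1)) - lam^2 * (star α' * γ)) ∧
  (δ' - star δ' = lam * (star α' * δ' + (star β' + 1) * (δ - 1) - (star γ' - 1))
      - lam^2 * (star α' * (δ - 1)))


/-- The metric-compatibility equations (M1)–(M6) for the quantum metric
`g = dr⊗dr + b(v*⊗v + λ(dr⊗v − v*⊗dr))`. -/
def MetricEqs (b : ℝ) (lam α β γ δ α' β' γ' δ' : ℂ) : Prop :=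
  (α' + star α' = lam * (α - star α)) ∧
  (β + star β = -(b * lam * (β' - star β'))) ∧
  (α + lam * b * star β = -(b * (star β' + lam * α'))) ∧
  (γ' + star γ' = lam * (γ - star γ + star α' + lam * star α)) ∧
  (δ + star δ + b * lam * (δ' - star δ') = lam * (star β - lam * b * star β')) ∧
  (γ + lam * b * γ' + b * (star δ' + lam * star δ) = lam * b * (star β' + lam * star β))


/-- The primed-coefficient formulas (F1)–(F4). -/
def PrimedFormulas (lam α β γ δ α' β' γ' δ' : ℂ) : Prop :=
  (α' = (α - star α - lam * star β * α + lam^2 * (α * star α)) / (lam * star α)) ∧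
  (β' = (β - star β + lam * (star α - β * star β) + lam^2 * (star α * β)) / (lam * star α)) ∧
  (γ' = (γ - star γ + lam * (star α - star β * γ) + lam^2 * (star α * γ)) / (lam * star α)) ∧
  (δ' = (δ - star δ + lam * (star γ - star β * (δ - 1)) + lam^2 * (star α * (δ - 1)))
      / (lam * star α))


/-- 'Real' octuple: `α, δ, β′, γ′` real and `β, γ, α′, δ′` purely imaginary. -/
def RealOctuple (α β γ δ α' β' γ' δ' : ℂ) : Prop :=
  α.im = 0 ∧ δ.im = 0 ∧ β'.im = 0 ∧ γ'.im = 0 ∧ β.re = 0 ∧ γ.re = 0 ∧ α'.re = 0 ∧ δ'.re = 0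

/-- *-preservation for a candidate bimodule connection on the quantum 1-forms of the
2D bicrossproduct model: the equations (E1)–(E8) hold iff the primed coefficients
are given by the formulas (F1)–(F4); in particular each `(α,β,γ,δ)` with `α ≠ 0`
has exactly one *-preserving extension. -/
theorem stmt_12 (lam : ℂ) (hlam : lam ≠ 0) (hlam_im : lam.re = 0)
    (α β γ δ α' β' γ' δ' : ℂ) (hα : α ≠ 0) :
    StarEqs lam α β γ δ α' β' γ' δ' ↔ PrimedFormulas lam α β γ δ α' β' γ' δ' := by
  have hl : star lam = -lam := by
    apply Complex.ext <;> simp [hlam_im]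
  have ha : star α ≠ 0 := star_ne_zero.mpr hα
  constructor
  · rintro ⟨h1, h2, h3, h4, -⟩
    refine ⟨?_, ?_, ?_, ?_⟩ <;> rw [eq_div_iff (mul_ne_zero hlam ha)]
    · linear_combination -h1
    · linear_combination -h2
    · linear_combination -h3
    · linear_combination -h4
  · rintro ⟨h1, h2, h3, h4⟩
    have g1 := congrArg star h1
    have g2 := congrArg star h2
    have g3 := congrArg star h3
    have g4 := congrArg star h4
    simp only [star_div₀, star_mul', star_add, star_sub, star_pow, star_star, star_one, hl]
      at g1 g2 g3 g4
    unfold StarEqs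
    rw [g1, g2, g3, g4, h1, h2, h3, h4]
    clear g1 g2 g3 g4 h1 h2 h3 h4 hl
    generalize star α = a at *
    generalize star β = b at *
    generalize star γ = c at *
    generalize star δ = d at *
    refine ⟨?_, ?_, ?_, ?_, ?_, ?_, ?_, ?_⟩ <;> field_simp <;> ring
end

section
/- Fix b ∈ ℝ with b ≠ 0 and λ ∈ ℂ purely imaginary with λ ≠ 0 and 1 + bλ² ≠ 0. Suppose (α, β, γ, δ, α′, β′, γ′, δ′) ∈ ℂ⁸ with α ≠ 0 satisfies the *-preservation equations (E1)–(E8) and the metric-compatibility equations (M1)–(M6). Then α is real, β is purely imaginary, and the conic equation β(β + 2/λ) + α(1 + λβ) + (α²/b)(1 + bλ²) = 0 holds. -/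
/-- For a *-preserving metric-compatible connection on the 2D bicrossproduct model
with `α ≠ 0`: `α` is real, `β` is purely imaginary, and the conic equation holds. -/
theorem stmt_13 (b : ℝ) (hb : b ≠ 0) (lam : ℂ) (hlam : lam ≠ 0) (hlam_im : lam.re = 0)
    (hb_lam : 1 + (b : ℂ) * lam^2 ≠ 0)
    (α β γ δ α' β' γ' δ' : ℂ) (hα : α ≠ 0)
    (hE : StarEqs lam α β γ δ α' β' γ' δ')
    (hM : MetricEqs b lam α β γ δ α' β' γ' δ') :
    α.im = 0 ∧ β.re = 0 ∧
      β * (β + 2 / lam) + α * (1 + lam * β) + α^2 / (b : ℂ) * (1 + (b : ℂ) * lam^2) = 0 := by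
  obtain ⟨h1, h2, -, -, -, -, -, -⟩ := hE
  obtain ⟨m1, m2, m3, -, -, -⟩ := hM
  obtain ⟨l0, l⟩ := lam
  obtain ⟨a1, a2⟩ := α
  obtain ⟨x1, x2⟩ := β
  obtain ⟨p1, p2⟩ := α'
  obtain ⟨q1, q2⟩ := β'
  simp only at hlam_im
  subst hlam_im
  have hl : l ≠ 0 := by
    rintro rfl
    exact hlam (by apply Complex.ext <;> simp)
  have hbl : 1 - b * l ^ 2 ≠ 0 := by
    intro h
    apply hb_lam
    apply Complex.ext
    · simp [pow_two]; linarith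
    · simp [pow_two]
  simp [Complex.ext_iff, pow_two] at h1 h2 m1 m2 m3
  obtain ⟨h1r, h1i⟩ := h1
  obtain ⟨h2r, h2i⟩ := h2
  obtain ⟨m3r, m3i⟩ := m3
  have e1 : p1 = -l * a2 := by linarith
  have e2 : x1 = b * l * q2 := by linarith
  have e3 : a2 = b * q2 := by
    apply mul_left_cancel₀ hbl
    subst e1 e2
    linarith
  subst e1 e2 e3
  have e4 : q1 * b = -a1 - b * l * x2 + b * l * p2 := by linarith
  have hq : q2 = 0 := by
    by_contra hq
    have hy : l * (p2 + x2) = 2 := by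
      apply mul_left_cancel₀ (mul_ne_zero hb hq)
      linarith
    have hP : a1 * (p2 - x2) = l * (a1 ^ 2 - (b * q2) ^ 2) := by
      apply mul_left_cancel₀ hl
      linarith
    have hC : b * (q1 - 1) - a1 + l ^ 2 * b * a1 + l * b * x2 = 0 := by
      apply mul_left_cancel₀ (mul_ne_zero hl hq)
      linarith
    obtain ⟨w, hw⟩ : ∃ w, w = 1 - l * x2 := ⟨_, rfl⟩
    have hp : l * p2 = 1 + w := by linarith
    have hx : l * x2 = 1 - w := by linarith
    have e4' : q1 * b = -a1 + 2 * b * w := by linear_combination e4 - b * hx + b * hp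
    have hC' : b * w = a1 * (2 - b * l ^ 2) := by linear_combination hC - e4' - b * hx
    have hP' : 2 * a1 * w = l ^ 2 * (a1 ^ 2 - (b * q2) ^ 2) := by
      linear_combination l * hP - a1 * hp + a1 * hx
    have hF : b * w ^ 2 - b + l ^ 2 * a1 * b * w - l ^ 2 * (a1 ^ 2 - (b * q2) ^ 2) = 0 := by
      have h3 : 2 * b * (l * x2) = b * (l * x2) ^ 2 + l ^ 2 * a1 * (q1 * b - b)
          + l ^ 2 * (b * q2) ^ 2 + l ^ 2 * a1 * b * (l * x2) := by
        linear_combination l * b * h2i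
      rw [hx, e4'] at h3
      linear_combination -h3
    apply hb
    linear_combination -hF + w * hC' + hP'
  subst hq
  have ha : a1 ≠ 0 := by
    rintro rfl
    exact hα (by apply Complex.ext <;> simp)
  have e5 : p2 = x2 + l * a1 := by
    apply mul_left_cancel₀ (mul_ne_zero hl ha)
    linarith
  subst e5
  refine ⟨by simp, by simp, ?_⟩
  have hbC : (b : ℂ) ≠ 0 := by exact_mod_cast hb
  have key : b * l * (-x2 ^ 2 + a1 * (1 - l * x2)) + b * 2 * x2 + l * a1 ^ 2 * (1 - b * l ^ 2) = 0 := by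
    linear_combination b * h2i + l * a1 * e4
  have hL : (⟨0, l⟩ : ℂ) = l * Complex.I := by apply Complex.ext <;> simp
  have hA : (⟨a1, b * 0⟩ : ℂ) = a1 := by apply Complex.ext <;> simp
  have hX : (⟨b * l * 0, x2⟩ : ℂ) = x2 * Complex.I := by apply Complex.ext <;> simp
  have hlC : (l : ℂ) ≠ 0 := by exact_mod_cast hl
  have keyC := congrArg (fun t : ℝ => (t : ℂ)) key
  push_cast at keyC
  rw [hL, hA, hX]
  have hI := Complex.I_ne_zero
  have hI2 := Complex.I_sq
  field_simp
  rw [hI2]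
  linear_combination keyC
end

section
/- Fix b ∈ ℝ with b ≠ 0 and λ ∈ ℂ purely imaginary with λ ≠ 0 and 1 + bλ² ≠ 0. Let (α, β, γ, δ, α′, β′, γ′, δ′) ∈ ℂ⁸ be 'real' (α, δ, β′, γ′ real and β, γ, α′, δ′ purely imaginary) with α ≠ 0. Then it satisfies both the *-preservation equations (E1)–(E8) and the metric-compatibility equations (M1)–(M6) if and only if the primed coefficients are given by (F1)–(F4) and the unprimed coefficients satisfy either (1) the conic equation β(β + 2/λ) + α(1 + λβ) + (α²/b)(1 + bλ²) = 0 together with γ = −λα/2 and δ = −λβ/2, or (2) α = b/(1 + bλ²), β = −2/λ, and λγ + δ = (2 + bλ²)/(2(1 + bλ²)) with δ ∈ ℝ arbitrary. (The two families meet exactly at the point of case (2) with δ = 1.) -/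
lemma star_of_im_zero {z : ℂ} (h : z.im = 0) : star z = z := by
  apply Complex.ext <;> simp [h]

lemma star_of_re_zero {z : ℂ} (h : z.re = 0) : star z = -z := by
  apply Complex.ext <;> simp [h]

/-- Moduli of 'real' *-preserving metric-compatible connections on the 2D
bicrossproduct model: a 'real' octuple with `α ≠ 0` satisfies (E1)–(E8) and
(M1)–(M6) iff the primed coefficients are given by (F1)–(F4) and the unprimed
coefficients lie either (1) on the conic with `γ = −λα/2`, `δ = −λβ/2`, or (2) on
the line `α = b/(1+bλ²)`, `β = −2/λ`, `λγ + δ = (2+bλ²)/(2(1+bλ²))`. -/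
theorem stmt_14 (b : ℝ) (hb : b ≠ 0) (lam : ℂ) (hlam : lam ≠ 0) (hlam_im : lam.re = 0)
    (hb_lam : 1 + (b : ℂ) * lam^2 ≠ 0)
    (α β γ δ α' β' γ' δ' : ℂ) (hα : α ≠ 0)
    (hreal : RealOctuple α β γ δ α' β' γ' δ') :
    (StarEqs lam α β γ δ α' β' γ' δ' ∧ MetricEqs b lam α β γ δ α' β' γ' δ')
    ↔ (PrimedFormulas lam α β γ δ α' β' γ' δ' ∧
        ((β * (β + 2 / lam) + α * (1 + lam * β) + α^2 / (b : ℂ) * (1 + (b : ℂ) * lam^2) = 0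
            ∧ γ = -(lam * α / 2) ∧ δ = -(lam * β / 2))
          ∨ (α = (b : ℂ) / (1 + (b : ℂ) * lam^2) ∧ β = -(2 / lam) ∧
              lam * γ + δ = (2 + (b : ℂ) * lam^2) / (2 * (1 + (b : ℂ) * lam^2))))) := by
  obtain ⟨h1, h2, h3, h4, h5, h6, h7, h8⟩ := hreal
  replace h1 := star_of_im_zero h1
  replace h2 := star_of_im_zero h2
  replace h3 := star_of_im_zero h3
  replace h4 := star_of_im_zero h4
  replace h5 := star_of_re_zero h5
  replace h6 := star_of_re_zero h6
  replace h7 := star_of_re_zero h7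
  replace h8 := star_of_re_zero h8
  have hbc : (b : ℂ) ≠ 0 := by exact_mod_cast hb
  unfold StarEqs MetricEqs PrimedFormulas
  rw [h1, h2, h3, h4, h5, h6, h7, h8]
  clear h1 h2 h3 h4 h5 h6 h7 h8 hlam_im
  generalize (b : ℂ) = c at *
  clear hb b
  have hLa : lam * α ≠ 0 := mul_ne_zero hlam hα
  constructor
  · rintro ⟨⟨e1, e2, e3, e4, e5, e6, e7, e8⟩, m1, m2, m3, m4, m5, m6⟩
    have a1 : α' = β + lam * α := by
      apply mul_left_cancel₀ hLa
      linear_combination -e1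
    clear e5 e6 e7 e8 m1 m2
    refine ⟨⟨?_, ?_, ?_, ?_⟩, ?_⟩
    · rw [eq_div_iff hLa]; linear_combination -e1
    · rw [eq_div_iff hLa]; linear_combination -e2
    · rw [eq_div_iff hLa]; linear_combination -e3
    · rw [eq_div_iff hLa]; linear_combination -e4
    subst a1
    have con : lam * c * β^2 + 2 * c * β + lam * c * α * (1 + lam * β)
        + lam * α^2 * (1 + c * lam^2) = 0 := by
      linear_combination lam * α * m3 + c * e2
    have fac : (2 + lam * β) * (2 * γ + lam * α) = 0 := by
      linear_combination lam * α * m4 + 2 * e3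
    rcases mul_eq_zero.1 fac with f | f
    · right
      have hβ : β = -(2 / lam) := by field_simp; linear_combination f
      have hα' : α * (1 + c * lam^2) = c := by
        grind
      refine ⟨?_, hβ, ?_⟩
      · rw [eq_div_iff hb_lam]; exact hα'
      · rw [eq_div_iff (mul_ne_zero two_ne_zero hb_lam)]
        grind
    · left
      have hγ : γ = -(lam * α / 2) := by linear_combination f / 2
      have hd : lam * α * (1 + c * lam^2) * (2 * δ + lam * β) = 0 := by
        linear_combination lam * α * (m5 + 2 * lam * m6 - lam^2 * c * m4 + lam^2 * m3
          - (lam + lam^3 * c) * f)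
      refine ⟨?_, hγ, ?_⟩
      · field_simp
        linear_combination con
      · have := (mul_eq_zero.1 hd).resolve_left (mul_ne_zero hLa hb_lam)
        linear_combination this / 2
  · rintro ⟨⟨e1, e2, e3, e4⟩, h⟩
    rw [eq_div_iff hLa] at e1 e2 e3 e4
    have a1 : α' = β + lam * α := by
      apply mul_left_cancel₀ hLa
      linear_combination e1
    subst a1
    have e4' : δ' * α = -γ + β * (δ - 1) + lam * α * (δ - 1) := by
      apply mul_left_cancel₀ hlam
      linear_combination e4
    have con : lam * c * β^2 + 2 * c * β + lam * c * α * (1 + lam * β)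
        + lam * α^2 * (1 + c * lam^2) = 0 := by
      rcases h with ⟨h, -, -⟩ | ⟨ha, hβ, -⟩
      · field_simp at h
        linear_combination h
      · rw [eq_div_iff hb_lam] at ha
        have hβ' : β * lam = -2 := by rw [hβ]; field_simp
        grind
    have fac : (2 + lam * β) * (2 * γ + lam * α) = 0 := by
      rcases h with ⟨-, h, -⟩ | ⟨-, hβ, -⟩
      · rw [h]; ring
      · rw [hβ]; field_simp; ring
    have K : 2 * δ + 2 * lam * γ + lam^2 * α + lam * β = 0 := by
      rcases h with ⟨-, hγ, hδ⟩ | ⟨ha, hβ, hd⟩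
      · rw [hγ, hδ]; ring
      · have hβ' : β * lam = -2 := by rw [hβ]; field_simp
        rw [eq_div_iff hb_lam] at ha
        rw [eq_div_iff (mul_ne_zero two_ne_zero hb_lam)] at hd
        apply mul_left_cancel₀ hb_lam
        linear_combination hd + lam^2 * ha + (1 + c * lam^2) * hβ'
    have Q : (2 * γ + lam * α) * (lam * α * (1 + c * lam^2) + 3 * c * lam + 2 * c * lam^2 * β)
        = 0 := by
      rcases h with ⟨-, hγ, -⟩ | ⟨ha, hβ, -⟩
      · rw [hγ]; ring
      · have hβ' : β * lam = -2 := by rw [hβ]; field_simp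
        rw [eq_div_iff hb_lam] at ha
        linear_combination (2 * γ + lam * α) * (lam * ha + 2 * c * lam * hβ')
    have m3 : α + lam * c * -β = -(c * (β' + lam * (β + lam * α))) := by
      apply mul_left_cancel₀ hLa
      linear_combination con + c * e2
    have m4 : γ' + γ' = lam * (γ - -γ + -(β + lam * α) + lam * α) := by
      apply mul_left_cancel₀ hLa
      linear_combination lam * 0 + fac + 2 * e3
    have m6 : γ + lam * c * γ' + c * (-δ' + lam * δ) = lam * c * (β' + lam * -β) := by
      apply mul_left_cancel₀ hLa
      linear_combination -c * lam * e2 + c * lam * e3 - c * e4 - c * lam * β / 2 * K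
        - lam / 2 * con + Q / 2
    refine ⟨⟨?_, ?_, ?_, ?_, ?_, ?_, ?_, ?_⟩, ?_, ?_, m3, m4, ?_, m6⟩
    · ring
    · linear_combination -e2
    · linear_combination -e3
    · linear_combination -e4
    · linear_combination -e2
    · linear_combination lam * e2
    · apply mul_left_cancel₀ hLa
      linear_combination -lam * γ * e2 + lam * (β + lam * α) * e3
    · apply mul_left_cancel₀ hLa
      linear_combination (2 + lam * (β + lam * α)) * e4 - lam * (δ - 1) * e2 + lam * e3
    · ring
    · ring
    · linear_combination (1 + c * lam^2) * K - 2 * lam * m6 + lam^2 * c * m4 - lam^2 * m3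
end

section
/- Fix b ∈ ℝ with b ≠ 0 and λ ∈ ℂ purely imaginary with λ ≠ 0 and 1 + bλ² ≠ 0. Let c₁, c₂, c₃, c₄ ∈ ℂ with c₁, c₄ real and c₂, c₃ purely imaginary, and assume c₄ − λ(c₂ − c₃ + c₁λ) ≠ 0 and c₁ + b c₃ λ ≠ 0. Then there exists a unique quadruple (n₁, n₂, n₃, n₄) ∈ ℂ⁴ satisfying the lift conditions (L1)–(L4), and it is given by n₁ = (b c₃ λ² + b c₄ λ + c₁ λ + c₂)/(2(1 + bλ²)(c₄ − λ(c₂ − c₃ + c₁λ))), n₂ = 1/2, n₃ = −1/2 + λ n₁, and n₄ = −(c₃ − λc₁)(c₄ + λ(c₃ − (c₂ + λc₁)(2 + bλ²)))/(2(c₁ + b c₃ λ)(c₄ − λ(c₂ − c₃ + c₁λ))). Thus the skew-hermitian lift of 2-forms is uniquely determined by requiring the quantum Ricci tensor to have the same hermitian and quantum-symmetry properties as the quantum metric. -/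
/-- The lift conditions (L1)–(L4) on the coefficients `(n₁, n₂, n₃, n₄)` of a lift
`i(v∧dr)` of 2-forms, for curvature coefficients `c₁, c₂, c₃, c₄`:
(L1) splitting of the wedge map; (L2) skew-hermitian lift; (L3) quantum symmetry of
Ricci; (L4) hermitian Ricci. -/
def LiftConds (b : ℝ) (lam c₁ c₂ c₃ c₄ n₁ n₂ n₃ n₄ : ℂ) : Prop :=
  let lx := (n₁ + lam * b * n₃) / (1 + lam^2 * b)
  let y := (n₂ + lam * b * n₄) / (1 + lam^2 * b)
  let p := (-(lam * (2 + lam^2 * b) * n₁) + n₃) / (1 + lam^2 * b)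
  let lq := (-(lam * (2 + lam^2 * b) * n₂) + n₄) / (1 + lam^2 * b)
  (n₂ - n₃ + lam * n₁ = 1) ∧
  (n₁.re = 0 ∧ (n₄ - lam * n₃).re = 0 ∧ n₂ - lam * n₁ = -(star n₃)) ∧
  (2 * lam * (lx * c₃ + p * c₁) - (y * c₃ + lq * c₁) + (lx * c₄ + p * c₂) = 0) ∧
  ((lx * c₃ + p * c₁).im = 0 ∧ (y * c₄ + lq * c₂).im = 0 ∧
    lx * c₄ + p * c₂ = star (y * c₃ + lq * c₁))

theorem re_zero_iff (z : ℂ) : z.re = 0 ↔ star z = -z := by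
  constructor
  · intro h
    apply Complex.ext <;> simp [h]
  · intro h
    have := congrArg Complex.re h
    simp at this
    linarith

theorem im_zero_iff (z : ℂ) : z.im = 0 ↔ star z = z := by
  constructor
  · intro h
    apply Complex.ext <;> simp [h]
  · intro h
    have := congrArg Complex.im h
    simp at this
    linarith

/-- The skew-hermitian lift of 2-forms on the 2D bicrossproduct model is uniquely
determined by the symmetry and reality properties of the quantum Ricci tensor, and
is given by the stated formulas. -/
theorem stmt_17 (b : ℝ) (hb : b ≠ 0) (lam : ℂ) (hlam : lam ≠ 0) (hlam_im : lam.re = 0)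
    (hb_lam : 1 + (b : ℂ) * lam^2 ≠ 0)
    (c₁ c₂ c₃ c₄ : ℂ) (hc₁ : c₁.im = 0) (hc₄ : c₄.im = 0) (hc₂ : c₂.re = 0) (hc₃ : c₃.re = 0)
    (hden1 : c₄ - lam * (c₂ - c₃ + c₁ * lam) ≠ 0) (hden2 : c₁ + (b : ℂ) * c₃ * lam ≠ 0) :
    ∀ n₁ n₂ n₃ n₄ : ℂ,
      LiftConds b lam c₁ c₂ c₃ c₄ n₁ n₂ n₃ n₄
      ↔ (n₁ = ((b : ℂ) * c₃ * lam^2 + (b : ℂ) * c₄ * lam + c₁ * lam + c₂)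
            / (2 * (1 + (b : ℂ) * lam^2) * (c₄ - lam * (c₂ - c₃ + c₁ * lam))) ∧
          n₂ = 1/2 ∧
          n₃ = -(1/2) + lam * n₁ ∧
          n₄ = -((c₃ - lam * c₁) * (c₄ + lam * (c₃ - (c₂ + lam * c₁) * (2 + (b : ℂ) * lam^2))))
            / (2 * (c₁ + (b : ℂ) * c₃ * lam) * (c₄ - lam * (c₂ - c₃ + c₁ * lam)))) := by
  intro n₁ n₂ n₃ n₄
  have hbs : star (b : ℂ) = b := by simp
  have hD : 1 + lam^2 * (b : ℂ) ≠ 0 := by rwa [mul_comm]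
  have h2s : star (2 : ℂ) = 2 := by simp
  have h1s : star (1 : ℂ) = 1 := by simp
  rw [re_zero_iff] at hlam_im hc₂ hc₃
  rw [im_zero_iff] at hc₁ hc₄
  simp only [LiftConds, re_zero_iff, im_zero_iff]
  simp only [star_add, star_sub, star_neg, star_mul', star_div₀, star_pow, hbs, h2s, h1s,
    hlam_im, hc₁, hc₂, hc₃, hc₄, neg_sq]
  constructor
  · rintro ⟨hL1, ⟨h1, h4, h3⟩, hS, hE, -, hA⟩
    have e3 : star n₃ = lam * n₁ - n₂ := by rw [eq_neg_iff_add_eq_zero] at h3; linear_combination h3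
    have e3' : n₃ = n₂ + lam * n₁ - 1 := by linear_combination -hL1
    rw [h1, e3, e3'] at hE
    field_simp at hE
    have hn2 : n₂ = 1/2 := by
      have : (c₁ + (b : ℂ) * c₃ * lam) * (2 * n₂ - 1) = 0 := by
        linear_combination -hE
      rcases mul_eq_zero.1 this with h | h
      · exact absurd h hden2
      · linear_combination h / 2
    have hn3 : n₃ = -(1/2) + lam * n₁ := by rw [e3', hn2]; ring
    have e4 : star n₄ = -n₄ := by
      rw [e3, hn2, hn3] at h4
      linear_combination h4
    have h2 : star n₂ = n₂ := by rw [hn2]; simp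
    rw [e4, h2, hn2, hn3] at hA
    rw [hn2, hn3] at hS
    field_simp at hA hS
    have key : n₁ * (2 * (1 + (b : ℂ) * lam^2) * (c₄ - lam * (c₂ - c₃ + c₁ * lam))) =
        (b : ℂ) * c₃ * lam^2 + (b : ℂ) * c₄ * lam + c₁ * lam + c₂ := by
      linear_combination (hS + hA) / 2
    have hn1 := (eq_div_iff (mul_ne_zero (mul_ne_zero two_ne_zero hb_lam) hden1)).2 key
    refine ⟨hn1, hn2, hn3, ?_⟩
    rw [eq_div_iff (mul_ne_zero (mul_ne_zero two_ne_zero hden2) hden1)]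
    linear_combination (c₄ - lam * (c₂ - c₃ + c₁ * lam)) * (hA - hS) / 2 + lam * (c₃ - lam * c₁) * key
  · rintro ⟨hn1, hn2, hn3, hn4⟩
    have h1 : star n₁ = -n₁ := by
      rw [hn1]
      simp only [star_add, star_sub, star_neg, star_mul', star_div₀, star_pow, hbs, h2s, h1s,
        hlam_im, hc₁, hc₂, hc₃, hc₄, neg_sq]
      rw [← neg_div]
      congr 1 <;> ring
    have h4 : star n₄ = -n₄ := by
      rw [hn4]
      simp only [star_add, star_sub, star_neg, star_mul', star_div₀, star_pow, hbs, h2s, h1s,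
        hlam_im, hc₁, hc₂, hc₃, hc₄, neg_sq]
      rw [← neg_div]
      congr 1 <;> ring
    have h2 : star n₂ = n₂ := by rw [hn2]; simp
    have h3 : star n₃ = n₃ := by
      rw [hn3]
      simp only [star_add, star_neg, star_mul', star_div₀, h2s, h1s, hlam_im, h1]
      ring
    have key := (eq_div_iff (mul_ne_zero (mul_ne_zero two_ne_zero hb_lam) hden1)).1 hn1
    have key4 := (eq_div_iff (mul_ne_zero (mul_ne_zero two_ne_zero hden2) hden1)).1 hn4
    simp only [h1, h2, h3, h4]
    clear hn1 hn4
    subst hn2 hn3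
    have M : c₃ + 2 * n₄ * (c₁ + (b : ℂ) * c₃ * lam) - lam * (2 + lam^2 * b) * c₁
        - lam * ((n₁ * 2 + lam * b * (-1 + n₁ * lam * 2)) * c₃ +
          (-(n₁ * lam * 2 * (2 + lam ^ 2 * b)) + (-1 + n₁ * lam * 2)) * c₁) = 0 := by
      apply (mul_eq_zero.1 _).resolve_left hden1
      linear_combination key4 - lam * (c₃ - lam * c₁) * key
    refine ⟨by ring, ⟨trivial, by ring, by ring⟩, ?_, by ring, by ring, ?_⟩
    · field_simp
      linear_combination key - M
    · field_simp
      linear_combination key + M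
end

section
/- Fix b ∈ ℝ with b ≠ 0 and λ ∈ ℂ purely imaginary with λ ≠ 0 and 1 + bλ² ≠ 0. Let α ∈ ℝ with α ≠ 0 and let k ∈ ℂ satisfy k² = 4 − (α²λ²/b)(4 + 3bλ²) and k ≠ 1. Define the conic-family curvature coefficients c₁ = α(k − 1), c₂ = −(4α²λ² + b(3α²λ⁴ − αλ² + αkλ² + k − 2))/(2bλ), c₃ = −(4α²λ² + b(3α²λ⁴ + αλ² − αkλ² + k − 2))/(2bλ), c₄ = −α(k − 1)(1 + bλ²)/b, and assume c₄ − λ(c₂ − c₃ + c₁λ) ≠ 0 and c₁ + b c₃ λ ≠ 0. Then the two identities hold: −(1 + bλ²)(c₂c₃ − c₁c₄)/(2(c₄ − λ(c₂ − c₃ + c₁λ))) = b(2 − k)/(2αλ²(k − 1)) and (λ((1 + bλ²)(c₁λ − c₃) + c₂(2 + bλ²)) − c₄)/(c₁ + b c₃ λ) = 1/b; consequently the quantum Ricci tensor equals ((2 − k)/(2αλ²(k − 1)))·(1/r²) times the quantum metric g. In particular, at the quantum Levi-Civita point α = 8b/(4 + 7bλ²), k = 2(4 − bλ²)/(4 +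 7bλ²), the proportionality factor is (4 + 7bλ²)/(4 − 9bλ²), so Ricci = ((4 + 7bλ²)/(4 − 9bλ²))·g/r². -/
/-- Quantum Ricci tensor of the conic family of connections on the 2D bicrossproduct
model: for the conic-family curvature coefficients the two stated identities hold, so
Ricci = ((2−k)/(2αλ²(k−1)))·g/r²; in particular at the quantum Levi-Civita point the
proportionality factor is (4+7bλ²)/(4−9bλ²). -/
theorem stmt_18 (b : ℝ) (hb : b ≠ 0) (lam : ℂ) (hlam : lam ≠ 0) (hlam_im : lam.re = 0)
    (hb_lam : 1 + (b : ℂ) * lam^2 ≠ 0)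
    (α : ℝ) (hα : α ≠ 0) (k : ℂ)
    (hk : k^2 = 4 - ((α : ℂ)^2 * lam^2 / (b : ℂ)) * (4 + 3 * (b : ℂ) * lam^2))
    (hk1 : k ≠ 1)
    (c₁ c₂ c₃ c₄ : ℂ)
    (hc₁ : c₁ = (α : ℂ) * (k - 1))
    (hc₂ : c₂ = -((4 * (α : ℂ)^2 * lam^2
        + (b : ℂ) * (3 * (α : ℂ)^2 * lam^4 - (α : ℂ) * lam^2 + (α : ℂ) * k * lam^2 + k - 2))
      / (2 * (b : ℂ) * lam)))
    (hc₃ : c₃ = -((4 * (α : ℂ)^2 * lam^2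
        + (b : ℂ) * (3 * (α : ℂ)^2 * lam^4 + (α : ℂ) * lam^2 - (α : ℂ) * k * lam^2 + k - 2))
      / (2 * (b : ℂ) * lam)))
    (hc₄ : c₄ = -((α : ℂ) * (k - 1) * (1 + (b : ℂ) * lam^2) / (b : ℂ)))
    (hden1 : c₄ - lam * (c₂ - c₃ + c₁ * lam) ≠ 0)
    (hden2 : c₁ + (b : ℂ) * c₃ * lam ≠ 0) :
    (-((1 + (b : ℂ) * lam^2) * (c₂ * c₃ - c₁ * c₄))
        / (2 * (c₄ - lam * (c₂ - c₃ + c₁ * lam)))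
      = (b : ℂ) * (2 - k) / (2 * (α : ℂ) * lam^2 * (k - 1))) ∧
    ((lam * ((1 + (b : ℂ) * lam^2) * (c₁ * lam - c₃) + c₂ * (2 + (b : ℂ) * lam^2)) - c₄)
        / (c₁ + (b : ℂ) * c₃ * lam)
      = 1 / (b : ℂ)) ∧
    (((α : ℂ) = 8 * (b : ℂ) / (4 + 7 * (b : ℂ) * lam^2) ∧
        k = 2 * (4 - (b : ℂ) * lam^2) / (4 + 7 * (b : ℂ) * lam^2)) →
      (2 - k) / (2 * (α : ℂ) * lam^2 * (k - 1))
        = (4 + 7 * (b : ℂ) * lam^2) / (4 - 9 * (b : ℂ) * lam^2)) := by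
  have hb' : (b : ℂ) ≠ 0 := by exact_mod_cast hb
  have hα' : (α : ℂ) ≠ 0 := by exact_mod_cast hα
  have hk1' : k - 1 ≠ 0 := sub_ne_zero.mpr hk1
  generalize (b : ℂ) = B at *
  generalize (α : ℂ) = a at *
  have hk2 : a^2 * lam^2 * (4 + 3 * B * lam^2) = B * (4 - k^2) := by
    rw [hk]; field_simp; ring
  have h2 : c₂ = -(((2 - k) * (1 + k) + a * lam^2 * (k - 1)) / (2 * lam)) := by
    rw [hc₂]; field_simp; linear_combination (-1) * hk2
  have h3 : c₃ = -(((2 - k) * (1 + k) - a * lam^2 * (k - 1)) / (2 * lam)) := by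
    rw [hc₃]; field_simp; linear_combination (-1) * hk2
  have hd : c₄ - lam * (c₂ - c₃ + c₁ * lam) = c₄ := by
    rw [h2, h3, hc₁]; field_simp; ring
  have hn : c₂ * c₃ - c₁ * c₄ = (2 - k) / lam^2 := by
    rw [h2, h3, hc₁, hc₄]; field_simp
    linear_combination (k - 1)^2 * hk2
  refine ⟨?_, ?_, ?_⟩
  · rw [hd, hn, hc₄]; field_simp
  · rw [div_eq_div_iff hden2 hb', h2, h3, hc₁, hc₄]; field_simp; ring
  · rintro ⟨ha, hkk⟩
    have hD : 4 + 7 * B * lam^2 ≠ 0 := by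
      intro h; apply hα'; rw [ha, h, div_zero]
    have e1 : k - 1 = (4 - 9 * B * lam^2) / (4 + 7 * B * lam^2) := by
      rw [hkk, eq_div_iff hD, sub_mul, div_mul_cancel₀ _ hD]; ring
    have e2 : 2 - k = 16 * B * lam^2 / (4 + 7 * B * lam^2) := by
      rw [hkk, eq_div_iff hD, sub_mul, div_mul_cancel₀ _ hD]; ring
    have hE : 4 - 9 * B * lam^2 ≠ 0 := by
      intro h; apply hk1'; rw [e1, h, zero_div]
    rw [e1, e2, ha]; field_simp; ring
end

section
/- Let λ, α, β, γ, δ, α′, β′, γ′, δ′ ∈ ℂ with λ ≠ 0 and α ≠ 0. Define the linear map σ on ℂ²⊗ℂ² (with basis e₁, e₂ of ℂ²) by σ(e₁⊗e₁) = (1 + λα′)e₁⊗e₁ + λβ′ e₁⊗e₂ + λγ′ e₂⊗e₁ + λδ′ e₂⊗e₂, σ(e₂⊗e₁) = λα e₁⊗e₁ + (1 + λβ) e₁⊗e₂ + λγ e₂⊗e₁ + λδ e₂⊗e₂, σ(e₁⊗e₂) = e₂⊗e₁, and σ(e₂⊗e₂) = e₂⊗e₂. Then σ satisfies the braid relation (σ⊗id)∘(id⊗σ)∘(σ⊗id)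 = (id⊗σ)∘(σ⊗id)∘(id⊗σ) on ℂ²⊗ℂ²⊗ℂ² if and only if δ = βγ/α, α′ = −(1 + λβ)/λ, β′ = −β(1 + λβ)/(αλ), γ′ = −γ(1 + λβ)/(αλ), and δ′ = −βγ(1 + λβ)/(α²λ). -/
open TensorProduct

noncomputable def braidSigma (lam α β γ δ α' β' γ' δ' : ℂ) :
    ((Fin 2 → ℂ) ⊗[ℂ] (Fin 2 → ℂ)) →ₗ[ℂ] ((Fin 2 → ℂ) ⊗[ℂ] (Fin 2 → ℂ)) :=
  let e := Pi.basisFun ℂ (Fin 2)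
  (e.tensorProduct e).constr ℂ (fun ab =>
    if ab = (0, 0) then
      (1 + lam * α') • (e 0 ⊗ₜ e 0) + (lam * β') • (e 0 ⊗ₜ e 1)
        + (lam * γ') • (e 1 ⊗ₜ e 0) + (lam * δ') • (e 1 ⊗ₜ e 1)
    else if ab = (1, 0) then
      (lam * α) • (e 0 ⊗ₜ e 0) + (1 + lam * β) • (e 0 ⊗ₜ e 1)
        + (lam * γ) • (e 1 ⊗ₜ e 0) + (lam * δ) • (e 1 ⊗ₜ e 1)
    else if ab = (0, 1) then e 1 ⊗ₜ e 0
    else e 1 ⊗ₜ e 1)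

noncomputable def braid12 (lam α β γ δ α' β' γ' δ' : ℂ) :
    ((Fin 2 → ℂ) ⊗[ℂ] ((Fin 2 → ℂ) ⊗[ℂ] (Fin 2 → ℂ))) →ₗ[ℂ]
      ((Fin 2 → ℂ) ⊗[ℂ] ((Fin 2 → ℂ) ⊗[ℂ] (Fin 2 → ℂ))) :=
  (TensorProduct.assoc ℂ (Fin 2 → ℂ) (Fin 2 → ℂ) (Fin 2 → ℂ)).toLinearMap ∘ₗ
    (TensorProduct.map (braidSigma lam α β γ δ α' β' γ' δ') LinearMap.id) ∘ₗ
      (TensorProduct.assoc ℂ (Fin 2 → ℂ) (Fin 2 → ℂ) (Fin 2 → ℂ)).symm.toLinearMap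

noncomputable def braid23 (lam α β γ δ α' β' γ' δ' : ℂ) :
    ((Fin 2 → ℂ) ⊗[ℂ] ((Fin 2 → ℂ) ⊗[ℂ] (Fin 2 → ℂ))) →ₗ[ℂ]
      ((Fin 2 → ℂ) ⊗[ℂ] ((Fin 2 → ℂ) ⊗[ℂ] (Fin 2 → ℂ))) :=
  TensorProduct.map LinearMap.id (braidSigma lam α β γ δ α' β' γ' δ')

section helpers
variable (lam α β γ δ α' β' γ' δ' : ℂ)

noncomputable def bvec (i : Fin 2) : Fin 2 → ℂ := Pi.basisFun ℂ (Fin 2) i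

theorem sigma_basis (i j : Fin 2) :
    braidSigma lam α β γ δ α' β' γ' δ' (bvec i ⊗ₜ bvec j) =
    if (i, j) = (0, 0) then
      (1 + lam * α') • (bvec 0 ⊗ₜ bvec 0) + (lam * β') • (bvec 0 ⊗ₜ bvec 1)
        + (lam * γ') • (bvec 1 ⊗ₜ bvec 0) + (lam * δ') • (bvec 1 ⊗ₜ bvec 1)
    else if (i, j) = (1, 0) then
      (lam * α) • (bvec 0 ⊗ₜ bvec 0) + (1 + lam * β) • (bvec 0 ⊗ₜ bvec 1)
        + (lam * γ) • (bvec 1 ⊗ₜ bvec 0) + (lam * δ) • (bvec 1 ⊗ₜ bvec 1)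
    else if (i, j) = (0, 1) then bvec 1 ⊗ₜ bvec 0
    else bvec 1 ⊗ₜ bvec 1 := by
  unfold braidSigma bvec
  rw [← Module.Basis.tensorProduct_apply, Module.Basis.constr_basis]

theorem sigma00 : braidSigma lam α β γ δ α' β' γ' δ' (bvec 0 ⊗ₜ bvec 0) =
      (1 + lam * α') • (bvec 0 ⊗ₜ bvec 0) + (lam * β') • (bvec 0 ⊗ₜ bvec 1)
        + (lam * γ') • (bvec 1 ⊗ₜ bvec 0) + (lam * δ') • (bvec 1 ⊗ₜ bvec 1) := by
  rw [sigma_basis]; simp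

theorem sigma10 : braidSigma lam α β γ δ α' β' γ' δ' (bvec 1 ⊗ₜ bvec 0) =
      (lam * α) • (bvec 0 ⊗ₜ bvec 0) + (1 + lam * β) • (bvec 0 ⊗ₜ bvec 1)
        + (lam * γ) • (bvec 1 ⊗ₜ bvec 0) + (lam * δ) • (bvec 1 ⊗ₜ bvec 1) := by
  rw [sigma_basis]; simp

theorem sigma01 : braidSigma lam α β γ δ α' β' γ' δ' (bvec 0 ⊗ₜ bvec 1) =
    bvec 1 ⊗ₜ bvec 0 := by
  rw [sigma_basis]; simp

theorem sigma11 : braidSigma lam α β γ δ α' β' γ' δ' (bvec 1 ⊗ₜ bvec 1) =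
    bvec 1 ⊗ₜ bvec 1 := by
  rw [sigma_basis]; simp

theorem b23_apply (x y z : Fin 2 → ℂ) :
    braid23 lam α β γ δ α' β' γ' δ' (x ⊗ₜ (y ⊗ₜ z)) =
      x ⊗ₜ braidSigma lam α β γ δ α' β' γ' δ' (y ⊗ₜ z) := by
  simp [braid23]

theorem b12_apply (x y z : Fin 2 → ℂ) :
    braid12 lam α β γ δ α' β' γ' δ' (x ⊗ₜ (y ⊗ₜ z)) =
      TensorProduct.assoc ℂ _ _ _ (braidSigma lam α β γ δ α' β' γ' δ' (x ⊗ₜ y) ⊗ₜ z) := by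
  simp [braid12]

noncomputable def coord (i j k : Fin 2) :
    ((Fin 2 → ℂ) ⊗[ℂ] ((Fin 2 → ℂ) ⊗[ℂ] (Fin 2 → ℂ))) →ₗ[ℂ] ℂ :=
  ((Pi.basisFun ℂ (Fin 2)).tensorProduct
    ((Pi.basisFun ℂ (Fin 2)).tensorProduct (Pi.basisFun ℂ (Fin 2)))).coord (i, j, k)

theorem coord_apply (i j k a b c : Fin 2) : coord i j k (bvec a ⊗ₜ (bvec b ⊗ₜ bvec c)) =
    if a = i ∧ b = j ∧ c = k then 1 else 0 := by
  unfold coord bvec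
  rw [← Module.Basis.tensorProduct_apply, ← Module.Basis.tensorProduct_apply]
  simp only [Module.Basis.coord_apply, Module.Basis.repr_self, Finsupp.single_apply, Prod.mk.injEq]

theorem ext3 {f g : ((Fin 2 → ℂ) ⊗[ℂ] ((Fin 2 → ℂ) ⊗[ℂ] (Fin 2 → ℂ))) →ₗ[ℂ]
      ((Fin 2 → ℂ) ⊗[ℂ] ((Fin 2 → ℂ) ⊗[ℂ] (Fin 2 → ℂ)))}
    (h : ∀ i j k, f (bvec i ⊗ₜ (bvec j ⊗ₜ bvec k)) = g (bvec i ⊗ₜ (bvec j ⊗ₜ bvec k))) :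
    f = g := by
  refine ((Pi.basisFun ℂ (Fin 2)).tensorProduct
    ((Pi.basisFun ℂ (Fin 2)).tensorProduct (Pi.basisFun ℂ (Fin 2)))).ext ?_
  rintro ⟨i, j, k⟩
  rw [Module.Basis.tensorProduct_apply, Module.Basis.tensorProduct_apply]
  exact h i j k

end helpers

theorem stmt_19 (lam α β γ δ α' β' γ' δ' : ℂ) (hlam : lam ≠ 0) (hα : α ≠ 0) :
    (braid12 lam α β γ δ α' β' γ' δ' ∘ₗ braid23 lam α β γ δ α' β' γ' δ' ∘ₗ
        braid12 lam α β γ δ α' β' γ' δ'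
      = braid23 lam α β γ δ α' β' γ' δ' ∘ₗ braid12 lam α β γ δ α' β' γ' δ' ∘ₗ
          braid23 lam α β γ δ α' β' γ' δ')
    ↔ (δ = β * γ / α ∧
        α' = -((1 + lam * β) / lam) ∧
        β' = -(β * (1 + lam * β) / (α * lam)) ∧
        γ' = -(γ * (1 + lam * β) / (α * lam)) ∧
        δ' = -(β * γ * (1 + lam * β) / (α^2 * lam))) := by
  constructor
  · intro h
    have key := LinearMap.congr_fun h (bvec 1 ⊗ₜ (bvec 1 ⊗ₜ bvec 0))
    simp only [LinearMap.comp_apply, b12_apply, b23_apply, sigma00, sigma01, sigma10,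
      sigma11, map_add, map_smul, add_tmul, tmul_add, ← smul_tmul', tmul_smul, assoc_tmul] at key
    have k1 := congrArg (coord 0 0 0) key
    have k2 := congrArg (coord 0 0 1) key
    have k3 := congrArg (coord 0 1 0) key
    have k4 := congrArg (coord 0 1 1) key
    have k5 := congrArg (coord 1 0 0) key
    clear key h
    simp [coord_apply] at k1 k2 k3 k4 k5
    have hne : lam * α ≠ 0 := mul_ne_zero hlam hα
    have hA : lam * α' = -(1 + lam * β) := by
      apply mul_left_cancel₀ (mul_ne_zero hne hne)
      grind
    have hB : lam * α * (lam * β') = -(lam * β) * (1 + lam * β) := by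
      apply mul_left_cancel₀ hne
      grind
    have hC : lam * α * (lam * γ') = -(lam * γ) * (1 + lam * β) := by
      apply mul_left_cancel₀ hne
      grind
    have hd : lam * α * (lam * δ) = (lam * β) * (lam * γ) := by
      apply mul_left_cancel₀ hne
      grind
    have hD : lam * α * (lam * δ') = -(lam * δ) * (1 + lam * β) := by
      apply mul_left_cancel₀ hne
      grind
    have hδ : δ = β * γ / α := by
      field_simp
      apply mul_left_cancel₀ (mul_ne_zero hlam hlam)
      linear_combination hd
    refine ⟨hδ, ?_, ?_, ?_, ?_⟩
    · field_simp
      linear_combination hA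
    · field_simp
      apply mul_left_cancel₀ hlam
      linear_combination hB
    · field_simp
      apply mul_left_cancel₀ hlam
      linear_combination hC
    · subst hδ
      field_simp at hD ⊢
      linear_combination hD
  · rintro ⟨h1, h2, h3, h4, h5⟩
    have hA : 1 + lam * α' = - (lam * β) := by
      rw [h2]; field_simp; ring
    obtain ⟨p, hp⟩ : ∃ p, p * α = 1 := ⟨α⁻¹, inv_mul_cancel₀ hα⟩
    have hd : δ = β * γ * p := by
      rw [h1]; field_simp; linear_combination (-β * γ) * hp
    have hB : lam * β' = -(β * (1 + lam * β) * p) := by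
      rw [h3]; field_simp; linear_combination β * (1 + lam * β) * hp
    have hC : lam * γ' = -(γ * (1 + lam * β) * p) := by
      rw [h4]; field_simp; linear_combination γ * (1 + lam * β) * hp
    have hD : lam * δ' = -(β * γ * (1 + lam * β) * p ^ 2) := by
      rw [h5]; field_simp; linear_combination β * γ * (1 + lam * β) * (p * α + 1) * hp
    clear h1 h2 h3 h4 h5
    apply ext3
    intro i j k
    fin_cases i <;> fin_cases j <;> fin_cases k <;>
    simp only [Fin.zero_eta, Fin.mk_one, LinearMap.comp_apply, b12_apply, b23_apply, sigma00, sigma01, sigma10,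
      sigma11, map_add, map_smul, add_tmul, tmul_add, ← smul_tmul', tmul_smul, assoc_tmul, hA, hB, hC, hD, hd] <;>
    match_scalars <;> grind
end
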